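/- arXiv:2008.13224 — 2 statements merged into one kernel-verified Lean document; each statement's English description precedes it below -/
import Mathlib

section
/- Fix b ≥ 1. Let G and G* be gadgets such that V(G) ∩ V(G*) ≠ ∅, the designated vertices p(G*), q(G*) do not lie in V(G), and G* is an extended type-II gadget; here G may be trivial or of type I, II or III. Then there exists a ∈ {1,2,3} such that G ∪ G* contains an (a,b)-alternating-path R with t_a(R) ∈ {p(G), q(G)}, s_1(R) ∈ {p(G*), q(G*)}, |V(R) ∩ {p(G), q(G)}| = 1, and |V(R) ∩ {p(G*), q(G*)}| = 1. -/
/- Common definitions: digraphs as irreflexive-in-intent relations `V → V → Prop`,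
   directed paths as nonempty duplicate-free lists of vertices,
   subdivisions, gadgets, alternating paths and chains, following
   "Subdivisions in digraphs of large out-degree or large dichromatic number". -/

namespace Paper

variable {V : Type*}

/-- `p` is a directed path in the digraph `D`: a nonempty list of pairwise distinct
vertices in which consecutive vertices are joined by an arc of `D`.
Its length (number of arcs) is `p.length - 1`. -/
def IsDipathList (D : V → V → Prop) (p : List V) : Prop :=
  p ≠ [] ∧ p.Nodup ∧ p.Chain' D

/-- The out-degree of a vertex. -/
noncomputable def outDeg (D : V → V → Prop) (v : V) : ℕ :=
  Set.ncard {w | D v w}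

/-- The digraph `D` contains a subdivision of the digraph `F`: there is an injective
embedding `φ` of the branch vertices and, for every arc `(x,y)` of `F`, a directed path
in `D` from `φ x` to `φ y` of length at least one, such that the internal vertices of
these paths avoid the branch vertices and the paths of distinct arcs are internally
vertex-disjoint. -/
def ContainsSubdivisionOf {W : Type*} (D : V → V → Prop) (F : W → W → Prop) : Prop :=
  ∃ (φ : W → V) (P : W → W → List V),
    Function.Injective φ ∧
    (∀ ⦃x y⦄, F x y → IsDipathList D (P x y) ∧ (P x y).head? = some (φ x) ∧
      (P x y).getLast? = some (φ y) ∧ 2 ≤ (P x y).length ∧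
      ∀ z ∈ (P x y).tail.dropLast, ∀ w, φ w ≠ z) ∧
    (∀ ⦃x y x' y'⦄, F x y → F x' y' → (x, y) ≠ (x', y') →
      ∀ z ∈ (P x y).tail.dropLast, z ∉ P x' y')

/-- As `ContainsSubdivisionOf`, but moreover the subdivision spans exactly
the vertex set `S`. -/
def SpansSubdivisionOf {W : Type*} (D : V → V → Prop) (S : Set V) (F : W → W → Prop) : Prop :=
  ∃ (φ : W → V) (P : W → W → List V),
    Function.Injective φ ∧
    (∀ ⦃x y⦄, F x y → IsDipathList D (P x y) ∧ (P x y).head? = some (φ x) ∧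
      (P x y).getLast? = some (φ y) ∧ 2 ≤ (P x y).length ∧
      ∀ z ∈ (P x y).tail.dropLast, ∀ w, φ w ≠ z) ∧
    (∀ ⦃x y x' y'⦄, F x y → F x' y' → (x, y) ≠ (x', y') →
      ∀ z ∈ (P x y).tail.dropLast, z ∉ P x' y') ∧
    S = Set.range φ ∪ {z | ∃ x y, F x y ∧ z ∈ P x y}

/-- The biorientation of the triangle minus one arc: vertices `0,1,2` and arcs
`(0,1),(1,0),(1,2),(2,1),(0,2)`. -/
def K3e : Fin 3 → Fin 3 → Prop := fun x y =>
  (x, y) = (0, 1) ∨ (x, y) = (1, 0) ∨ (x, y) = (1, 2) ∨ (x, y) = (2, 1) ∨ (x, y) = (0, 2)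

/-- The biorientation of the complete graph on four vertices. -/
def K4bi : Fin 4 → Fin 4 → Prop := fun x y => x ≠ y

/-- The biorientation of the star with four edges (center `0`). -/
def S4bi : Fin 5 → Fin 5 → Prop := fun x y => x ≠ y ∧ (x = 0 ∨ y = 0)

/-- The orientation of the cycle of length `ℓ` (vertex set `ZMod ℓ`) determined by
`σ`: the edge `{x, x+1}` is oriented from `x` to `x+1` if `σ x = true`, and from
`x+1` to `x` otherwise. -/
def CycleOrientation (ℓ : ℕ) (σ : ZMod ℓ → Bool) : ZMod ℓ → ZMod ℓ → Prop :=
  fun x y => (σ x = true ∧ y = x + 1) ∨ (σ y = false ∧ x = y + 1)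

/-- The oriented cycle `C_{a,b}` on `2ab` vertices: going around the cycle
`ZMod (2ab)`, the arcs of the `j`-th block of `b` consecutive edges are oriented
forwards for even `j` and backwards for odd `j`; its sources are `s_j = 2bj`
and its sinks are `t_j = 2bj + b`, joined by `2a` internally disjoint directed
paths of length `b` each. -/
def Cab (a b : ℕ) : ZMod (2 * a * b) → ZMod (2 * a * b) → Prop := fun x y =>
  ∃ i : ℕ, i < 2 * a * b ∧
    (((i / b) % 2 = 0 ∧ x = (i : ZMod (2 * a * b)) ∧ y = ((i + 1 : ℕ) : ZMod (2 * a * b))) ∨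
     ((i / b) % 2 = 1 ∧ x = ((i + 1 : ℕ) : ZMod (2 * a * b)) ∧ y = (i : ZMod (2 * a * b))))

/-- The directed girth of `D` is at least `g`: every directed cycle
(a nonempty duplicate-free list `v :: p` with consecutive arcs and an arc from the
last vertex back to `v`) has length at least `g`. -/
def DirGirthGE (D : V → V → Prop) (g : ℕ) : Prop :=
  ∀ (v : V) (p : List V), (v :: p).Nodup → List.Chain D v (p ++ [v]) → g ≤ p.length + 1

/-- `D` is strongly connected. -/
def StronglyConnected (D : V → V → Prop) : Prop :=
  ∀ u v : V, Relation.ReflTransGen D u v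

/-- `D` is strongly `k`-arc-connected: after deleting any set of at most `k-1` arcs,
the digraph remains strongly connected. -/
def StronglyArcConnected (D : V → V → Prop) (k : ℕ) : Prop :=
  ∀ E : Finset (V × V), E.card < k →
    StronglyConnected (fun u v => D u v ∧ (u, v) ∉ E)

/-- `x` and `y` are consecutive (in this order) in the list `l`. -/
def adjIn (l : List V) (x y : V) : Prop := ∃ l₁ l₂, l = l₁ ++ x :: y :: l₂

/-- A type-I gadget in `D`: a directed cycle `p, q, rest…` of length at least `g`
through the arc `(p,q)`. -/
structure TypeIGadget (D : V → V → Prop) (g : ℕ) where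
  p : V
  q : V
  rest : List V
  nodup : (p :: q :: rest).Nodup
  chain : List.Chain D p (q :: (rest ++ [p]))
  glen : g ≤ rest.length + 2

def TypeIGadget.verts {D : V → V → Prop} {g : ℕ} (G : TypeIGadget D g) : Set V :=
  {x | x ∈ G.p :: G.q :: G.rest}

def TypeIGadget.arcs {D : V → V → Prop} {g : ℕ} (G : TypeIGadget D g) : V → V → Prop :=
  adjIn (G.p :: G.q :: (G.rest ++ [G.p]))

/-- A basic type-II gadget in `D` (with girth parameter `b`): vertices `p, q, r` and a
directed path `P₁` from `r` to `p` of length at least `2b² + b - 2` avoiding `q`,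
all of whose vertices send an arc to `q`. -/
structure BasicIIGadget (D : V → V → Prop) (b : ℕ) where
  p : V
  q : V
  r : V
  P₁ : List V
  path₁ : IsDipathList D P₁
  first₁ : P₁.head? = some r
  last₁ : P₁.getLast? = some p
  len₁ : 2 * b ^ 2 + b - 1 ≤ P₁.length
  hq : q ∉ P₁
  toq : ∀ x ∈ P₁, D x q

def BasicIIGadget.verts {D : V → V → Prop} {b : ℕ} (G : BasicIIGadget D b) : Set V :=
  insert G.q {x | x ∈ G.P₁}

def BasicIIGadget.arcs {D : V → V → Prop} {b : ℕ} (G : BasicIIGadget D b) :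
    V → V → Prop :=
  fun x y => adjIn G.P₁ x y ∨ (x ∈ G.P₁ ∧ y = G.q)

/-- An extended type-II gadget: a basic type-II gadget together with a directed path
`P₂` of length at least `b` ending at `r`, meeting `P₁` only in `r` and avoiding `q`,
such that either the first vertex of `P₂` sends an arc to the second vertex of `P₁`,
or some vertex of `P₁` other than `r` sends an arc to the first vertex of `P₂`. -/
structure ExtIIGadget (D : V → V → Prop) (b : ℕ) where
  p : V
  q : V
  r : V
  P₁ : List V
  path₁ : IsDipathList D P₁
  first₁ : P₁.head? = some r
  last₁ : P₁.getLast? = some p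
  len₁ : 2 * b ^ 2 + b - 1 ≤ P₁.length
  hq : q ∉ P₁
  toq : ∀ x ∈ P₁, D x q
  P₂ : List V
  path₂ : IsDipathList D P₂
  last₂ : P₂.getLast? = some r
  len₂ : b + 1 ≤ P₂.length
  inter : ∀ x ∈ P₁, x ∈ P₂ → x = r
  hq₂ : q ∉ P₂
  extra : (∃ z y, P₂.head? = some z ∧ P₁[1]? = some y ∧ D z y) ∨
          (∃ w z, w ∈ P₁ ∧ w ≠ r ∧ P₂.head? = some z ∧ D w z)

def ExtIIGadget.verts {D : V → V → Prop} {b : ℕ} (G : ExtIIGadget D b) : Set V :=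
  insert G.q ({x | x ∈ G.P₁} ∪ {x | x ∈ G.P₂})

def ExtIIGadget.arcs {D : V → V → Prop} {b : ℕ} (G : ExtIIGadget D b) : V → V → Prop :=
  fun x y => adjIn G.P₁ x y ∨ (x ∈ G.P₁ ∧ y = G.q) ∨ adjIn G.P₂ x y ∨
    (D x y ∧ ((G.P₂.head? = some x ∧ G.P₁[1]? = some y) ∨
              (x ∈ G.P₁ ∧ x ≠ G.r ∧ G.P₂.head? = some y)))

/-- A type-III gadget: vertices `p, q, r`, the arc `(p,q)`, and two internally
vertex-disjoint directed paths `P₁ : p → r` and `P₂ : q → r`, each of length at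
least `2b - 1`. -/
structure TypeIIIGadget (D : V → V → Prop) (b : ℕ) where
  p : V
  q : V
  r : V
  arc : D p q
  P₁ : List V
  P₂ : List V
  path₁ : IsDipathList D P₁
  path₂ : IsDipathList D P₂
  first₁ : P₁.head? = some p
  first₂ : P₂.head? = some q
  last₁ : P₁.getLast? = some r
  last₂ : P₂.getLast? = some r
  len₁ : 2 * b ≤ P₁.length
  len₂ : 2 * b ≤ P₂.length
  inter : ∀ x ∈ P₁, x ∈ P₂ → x = r

def TypeIIIGadget.verts {D : V → V → Prop} {b : ℕ} (G : TypeIIIGadget D b) : Set V :=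
  {x | x ∈ G.P₁} ∪ {x | x ∈ G.P₂}

def TypeIIIGadget.arcs {D : V → V → Prop} {b : ℕ} (G : TypeIIIGadget D b) :
    V → V → Prop :=
  fun x y => (x = G.p ∧ y = G.q) ∨ adjIn G.P₁ x y ∨ adjIn G.P₂ x y

/-- A trivial gadget: just the arc `(p,q)`. -/
structure TrivGadget (D : V → V → Prop) where
  p : V
  q : V
  arc : D p q

def TrivGadget.verts {D : V → V → Prop} (G : TrivGadget D) : Set V := {G.p, G.q}

def TrivGadget.arcs {D : V → V → Prop} (G : TrivGadget D) : V → V → Prop :=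
  fun x y => x = G.p ∧ y = G.q

/-- An `(a,b)`-alternating path in `D` (with 0-based indexing): vertices
`s 0, …, s (a-1)`, `t 0, …, t (a-1)` and pairwise internally disjoint directed paths
`Q i : s i → t i` and `Q' i : s (i+1) → t i`, forming an oriented path; every `Q' i`
and every `Q i` with `0 < i < a - 1` has length at least `b` (`Q 0` and `Q (a-1)`
may even be single vertices). -/
structure AltPath (D : V → V → Prop) (a b : ℕ) where
  s : Fin a → V
  t : Fin a → V
  Q : Fin a → List V
  Q' : Fin (a - 1) → List V
  path_Q : ∀ i, IsDipathList D (Q i)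
  first_Q : ∀ i, (Q i).head? = some (s i)
  last_Q : ∀ i, (Q i).getLast? = some (t i)
  path_Q' : ∀ i, IsDipathList D (Q' i)
  first_Q' : ∀ i : Fin (a - 1),
    (Q' i).head? = some (s ⟨i.val + 1, by have := i.isLt; omega⟩)
  last_Q' : ∀ i : Fin (a - 1),
    (Q' i).getLast? = some (t ⟨i.val, by have := i.isLt; omega⟩)
  len_Q : ∀ i : Fin a, 0 < i.val → i.val < a - 1 → b + 1 ≤ (Q i).length
  len_Q' : ∀ i, b + 1 ≤ (Q' i).length
  disj_QQ : ∀ i j : Fin a, i ≠ j → ∀ x ∈ Q i, x ∉ Q j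
  disj_Q'Q' : ∀ i j : Fin (a - 1), i ≠ j → ∀ x ∈ Q' i, x ∉ Q' j
  disj_QQ' : ∀ (i : Fin a) (j : Fin (a - 1)), ∀ x ∈ Q i, x ∈ Q' j →
    (j.val = i.val ∧ x = t i) ∨ (i.val = j.val + 1 ∧ x = s i)

def AltPath.verts {D : V → V → Prop} {a b : ℕ} (R : AltPath D a b) : Set V :=
  {x | (∃ i, x ∈ R.Q i) ∨ (∃ i, x ∈ R.Q' i)}

/-- A strong alternating path: additionally `Q 0` and `Q (a-1)` (hence all `Q i`)
have length at least `b`. -/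
def AltPath.Strong {D : V → V → Prop} {a b : ℕ} (R : AltPath D a b) : Prop :=
  ∀ i, b + 1 ≤ (R.Q i).length

def AltPath.arcs {D : V → V → Prop} {a b : ℕ} (R : AltPath D a b) : V → V → Prop :=
  fun x y => (∃ i, adjIn (R.Q i) x y) ∨ (∃ i, adjIn (R.Q' i) x y)

/-- A gadget allowed in a chain: type I (with `g = 4b²`), basic type II, or type III. -/
inductive ChainGadget (D : V → V → Prop) (b : ℕ) where
  | I : TypeIGadget D (4 * b ^ 2) → ChainGadget D b
  | II : BasicIIGadget D b → ChainGadget D b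
  | III : TypeIIIGadget D b → ChainGadget D b

def ChainGadget.pp {D : V → V → Prop} {b : ℕ} : ChainGadget D b → V
  | .I G => G.p
  | .II G => G.p
  | .III G => G.p

def ChainGadget.qq {D : V → V → Prop} {b : ℕ} : ChainGadget D b → V
  | .I G => G.q
  | .II G => G.q
  | .III G => G.q

def ChainGadget.verts {D : V → V → Prop} {b : ℕ} : ChainGadget D b → Set V
  | .I G => G.verts
  | .II G => G.verts
  | .III G => G.verts

def ChainGadget.arcs {D : V → V → Prop} {b : ℕ} : ChainGadget D b → V → V → Prop
  | .I G => G.arcs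
  | .II G => G.arcs
  | .III G => G.arcs

/-- A chain in `D`: a directed path (spine) `v 0, …, v m`, a set `A2` of spine arcs,
and a gadget for every arc in `A2` (arcs outside `A2` form `A1` and carry trivial
gadgets), such that each gadget has the endpoints of its arc as designated vertices,
meets the spine only in these two vertices, and two distinct gadgets meet only in
spine vertices. -/
structure GChain (D : V → V → Prop) (b m : ℕ) where
  v : Fin (m + 1) → V
  inj : Function.Injective v
  spine : ∀ i : Fin m, D (v i.castSucc) (v i.succ)
  A2 : Finset (Fin m)
  gad : (i : Fin m) → i ∈ A2 → ChainGadget D b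
  hp : ∀ (i : Fin m) (hi : i ∈ A2), (gad i hi).pp = v i.castSucc
  hq : ∀ (i : Fin m) (hi : i ∈ A2), (gad i hi).qq = v i.succ
  hspine : ∀ (i : Fin m) (hi : i ∈ A2) (j : Fin (m + 1)),
    v j ∈ (gad i hi).verts → j = i.castSucc ∨ j = i.succ
  hdisj : ∀ (i : Fin m) (hi : i ∈ A2) (j : Fin m) (hj : j ∈ A2), i ≠ j →
    ∀ x, x ∈ (gad i hi).verts → x ∈ (gad j hj).verts → ∃ k, x = v k

def GChain.verts {D : V → V → Prop} {b m : ℕ} (C : GChain D b m) : Set V :=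
  Set.range C.v ∪ {x | ∃ (i : Fin m) (hi : i ∈ C.A2), x ∈ (C.gad i hi).verts}

def GChain.arcs {D : V → V → Prop} {b m : ℕ} (C : GChain D b m) : V → V → Prop :=
  fun x y => (∃ i : Fin m, x = C.v i.castSucc ∧ y = C.v i.succ) ∨
    (∃ (i : Fin m) (hi : i ∈ C.A2), (C.gad i hi).arcs x y)

/-- The vertex set of the gadget `G_e` sitting on the `i`-th spine arc
(the trivial gadget for arcs of `A1`). -/
def GChain.gadVerts {D : V → V → Prop} {b m : ℕ} (C : GChain D b m) (i : Fin m) :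
    Set V :=
  if h : i ∈ C.A2 then (C.gad i h).verts else {C.v i.castSucc, C.v i.succ}

/-- An arbitrary gadget: trivial, type I (with `g = 4b²`), basic or extended type II,
or type III. -/
inductive GadgetAny (D : V → V → Prop) (b : ℕ) where
  | triv : TrivGadget D → GadgetAny D b
  | I : TypeIGadget D (4 * b ^ 2) → GadgetAny D b
  | II : BasicIIGadget D b → GadgetAny D b
  | IIext : ExtIIGadget D b → GadgetAny D b
  | III : TypeIIIGadget D b → GadgetAny D b

def GadgetAny.pp {D : V → V → Prop} {b : ℕ} : GadgetAny D b → V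
  | .triv G => G.p
  | .I G => G.p
  | .II G => G.p
  | .IIext G => G.p
  | .III G => G.p

def GadgetAny.qq {D : V → V → Prop} {b : ℕ} : GadgetAny D b → V
  | .triv G => G.q
  | .I G => G.q
  | .II G => G.q
  | .IIext G => G.q
  | .III G => G.q

def GadgetAny.verts {D : V → V → Prop} {b : ℕ} : GadgetAny D b → Set V
  | .triv G => G.verts
  | .I G => G.verts
  | .II G => G.verts
  | .IIext G => G.verts
  | .III G => G.verts

def GadgetAny.arcs {D : V → V → Prop} {b : ℕ} : GadgetAny D b → V → V → Prop
  | .triv G => G.arcs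
  | .I G => G.arcs
  | .II G => G.arcs
  | .IIext G => G.arcs
  | .III G => G.arcs

end Paper

namespace Paper

section Helpers

variable {V : Type*}

/-- `l` is a dipath from `u` to `v`. -/
def DP (E : V → V → Prop) (u v : V) (l : List V) : Prop :=
  IsDipathList E l ∧ l.head? = some u ∧ l.getLast? = some v

theorem DP.single (E : V → V → Prop) (u : V) : DP E u u [u] := by
  refine ⟨⟨by simp, by simp, ?_⟩, by simp, by simp⟩
  exact List.isChain_singleton u

theorem DP.first_mem {E : V → V → Prop} {u v : V} {l : List V} (h : DP E u v l) : u ∈ l :=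
  List.mem_of_head? h.2.1

theorem DP.last_mem {E : V → V → Prop} {u v : V} {l : List V} (h : DP E u v l) : v ∈ l :=
  List.mem_of_getLast? h.2.2

theorem DP.cons {E : V → V → Prop} {u v w : V} {l : List V} (h : DP E v w l)
    (huv : E u v) (hu : u ∉ l) : DP E u w (u :: l) := by
  obtain ⟨⟨h1, h2, h3⟩, h4, h5⟩ := h
  cases l with
  | nil => exact absurd rfl h1
  | cons a l =>
    simp at h4
    subst h4
    refine ⟨⟨by simp, List.nodup_cons.2 ⟨hu, h2⟩, ?_⟩, by simp, ?_⟩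
    · exact List.isChain_cons_cons.2 ⟨huv, h3⟩
    · rw [List.getLast?_cons_cons]; exact h5

theorem DP.append {E : V → V → Prop} {u v w : V} {l₁ l₂ : List V} (h₁ : DP E u v l₁)
    (h₂ : DP E v w l₂) (hd : ∀ x ∈ l₁, x ∈ l₂ → x = v) : DP E u w (l₁ ++ l₂.tail) := by
  induction l₁ generalizing u with
  | nil => exact absurd rfl h₁.1.1
  | cons a l ih =>
    have ha : a = u := by simpa using h₁.2.1
    subst ha
    cases l with
    | nil =>
      have : a = v := by simpa using h₁.2.2
      subst this
      have h2 := h₂.2.1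
      cases l₂ with
      | nil => simp at h2
      | cons c l₂ =>
        simp at h2
        subst h2
        simpa using h₂
    | cons c l =>
      obtain ⟨⟨h1, h2, h3⟩, h4, h5⟩ := h₁
      have h3' := List.isChain_cons_cons.1 h3
      have hn := List.nodup_cons.1 h2
      have hc : DP E c v (c :: l) := ⟨⟨by simp, hn.2, h3'.2⟩, by simp, by
        rw [List.getLast?_cons_cons] at h5; exact h5⟩
      have := ih hc (fun x hx hx2 => hd x (List.mem_cons_of_mem _ hx) hx2)
      rw [List.cons_append]
      refine DP.cons this h3'.1 ?_
      intro hmem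
      rcases List.mem_append.1 hmem with h | h
      · exact hn.1 h
      · have := hd a (by simp) (List.mem_of_mem_tail h)
        subst this
        exact hn.1 hc.last_mem

theorem DP.snoc {E : V → V → Prop} {u v w : V} {l : List V} (h : DP E u v l)
    (huv : E v w) (hu : w ∉ l) : DP E u w (l ++ [w]) := by
  have hvw : v ≠ w := fun e => hu (e ▸ h.last_mem)
  have h2 : DP E v w [v, w] := DP.cons (DP.single E w) huv (by simpa using hvw)
  have := h.append h2 (by
    intro x hx hx2
    simp at hx2
    rcases hx2 with rfl | rfl
    · rfl
    · exact absurd hx hu)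
  simpa using this

theorem mem_append_tail {E : V → V → Prop} {u v w : V} {l₁ l₂ : List V} (h₁ : DP E u v l₁)
    (h₂ : DP E v w l₂) (z : V) : z ∈ l₁ ++ l₂.tail ↔ z ∈ l₁ ∨ z ∈ l₂ := by
  have h2 := h₂.2.1
  have h1 := h₁.last_mem
  cases l₂ with
  | nil => simp at h2
  | cons c l₂ =>
    simp at h2
    subst h2
    simp only [List.mem_append, List.tail_cons, List.mem_cons]
    constructor
    · tauto
    · rintro (h | rfl | h)
      · exact Or.inl h
      · exact Or.inl h1
      · exact Or.inr h

theorem length_append_tail {E : V → V → Prop} {u v w : V} {l₁ l₂ : List V} (h₁ : DP E u v l₁)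
    (h₂ : DP E v w l₂) : (l₁ ++ l₂.tail).length + 1 = l₁.length + l₂.length := by
  have h2 := h₂.1.1
  cases l₂ with
  | nil => simp at h2
  | cons c l₂ => simp; omega

theorem DP.length_pos {E : V → V → Prop} {u v : V} {l : List V} (h : DP E u v l) :
    1 ≤ l.length := List.length_pos_of_mem h.first_mem

theorem DP.ne_of_length {E : V → V → Prop} {u v : V} {l : List V} (h : DP E u v l)
    (hl : 2 ≤ l.length) : u ≠ v := by
  rintro rfl
  obtain ⟨⟨h1, h2, h3⟩, h4, h5⟩ := h
  match l, hl with
  | a :: c :: l, _ =>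
    simp at h4
    subst h4
    rw [List.getLast?_cons_cons] at h5
    exact (List.nodup_cons.1 h2).1 (List.mem_of_getLast? h5)

theorem DP.length_of_ne {E : V → V → Prop} {u v : V} {l : List V} (h : DP E u v l)
    (hl : u ≠ v) : 2 ≤ l.length := by
  by_contra hc
  obtain ⟨⟨h1, h2, h3⟩, h4, h5⟩ := h
  match l, hc with
  | [], _ => exact h1 rfl
  | [a], _ =>
    simp at h4 h5
    exact hl (h4.symm.trans h5)
  | a :: c :: l, hc => simp at hc

/-- The conclusion of the theorem. -/
def Concl (E : V → V → Prop) (b : ℕ) (p q ps qs : V) : Prop :=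
    ∃ (a : ℕ) (ha : 0 < a), a ≤ 3 ∧
      ∃ R : AltPath E a b,
        (R.t ⟨a - 1, by omega⟩ = p ∨ R.t ⟨a - 1, by omega⟩ = q) ∧
        (R.s ⟨0, ha⟩ = ps ∨ R.s ⟨0, ha⟩ = qs) ∧
        (∀ z ∈ R.verts, z = p ∨ z = q → z = R.t ⟨a - 1, by omega⟩) ∧
        (∀ z ∈ R.verts, z = ps ∨ z = qs → z = R.s ⟨0, ha⟩)

theorem alt1 {E : V → V → Prop} {b : ℕ} {p q ps qs s t : V} {l : List V}
    (h : DP E s t l) (ht : t = p ∨ t = q) (hs : s = ps ∨ s = qs)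
    (h1 : ∀ z ∈ l, z = p ∨ z = q → z = t) (h2 : ∀ z ∈ l, z = ps ∨ z = qs → z = s) :
    Concl E b p q ps qs := by
  refine ⟨1, by norm_num, by norm_num, ⟨fun _ => s, fun _ => t, fun _ => l, fun _ => l,
    fun _ => h.1, fun _ => h.2.1, fun _ => h.2.2, fun i => i.elim0, fun i => i.elim0,
    fun i => i.elim0, ?_, fun i => i.elim0, ?_, fun i => i.elim0, fun _ i => i.elim0⟩,
    ht, hs, ?_, ?_⟩
  · intro i h1 h2; omega
  · intro i j hij; exact absurd (Subsingleton.elim i j) hij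
  · rintro z (⟨i, hi⟩ | ⟨i, hi⟩)
    · exact h1 z hi
    · exact i.elim0
  · rintro z (⟨i, hi⟩ | ⟨i, hi⟩)
    · exact h2 z hi
    · exact i.elim0

theorem alt2 {E : V → V → Prop} {b : ℕ} {p q ps qs s0 t0 s1 t1 : V} {l0 l0' l1 : List V}
    (h0 : DP E s0 t0 l0) (h0' : DP E s1 t0 l0') (h1 : DP E s1 t1 l1)
    (hl : b + 1 ≤ l0'.length)
    (d01 : ∀ z ∈ l0, z ∉ l1)
    (d00 : ∀ z ∈ l0, z ∈ l0' → z = t0)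
    (d10 : ∀ z ∈ l1, z ∈ l0' → z = s1)
    (ht : t1 = p ∨ t1 = q) (hs : s0 = ps ∨ s0 = qs)
    (e1 : ∀ z, z ∈ l0 ∨ z ∈ l0' ∨ z ∈ l1 → z = p ∨ z = q → z = t1)
    (e2 : ∀ z, z ∈ l0 ∨ z ∈ l0' ∨ z ∈ l1 → z = ps ∨ z = qs → z = s0) :
    Concl E b p q ps qs := by
  refine ⟨2, by norm_num, by norm_num, ⟨![s0, s1], ![t0, t1], ![l0, l1], fun _ => l0',
    ?_, ?_, ?_, fun _ => h0'.1, ?_, ?_, ?_, fun _ => hl, ?_, ?_, ?_⟩,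
    ?_, ?_, ?_, ?_⟩
  · exact Fin.forall_fin_two.2 ⟨h0.1, h1.1⟩
  · exact Fin.forall_fin_two.2 ⟨h0.2.1, h1.2.1⟩
  · exact Fin.forall_fin_two.2 ⟨h0.2.2, h1.2.2⟩
  · exact Fin.forall_fin_one.2 h0'.2.1
  · exact Fin.forall_fin_one.2 h0'.2.2
  · intro i h1 h2; omega
  · refine Fin.forall_fin_two.2 ⟨Fin.forall_fin_two.2 ⟨?_, ?_⟩, Fin.forall_fin_two.2 ⟨?_, ?_⟩⟩
    · intro h; exact absurd rfl h
    · intro _; exact d01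
    · intro _ z hz hz'; exact d01 z hz' hz
    · intro h; exact absurd rfl h
  · intro i j hij; exact absurd (Subsingleton.elim (α := Fin 1) i j) hij
  · refine Fin.forall_fin_two.2 ⟨Fin.forall_fin_one.2 ?_, Fin.forall_fin_one.2 ?_⟩
    · intro z hz hz'; exact Or.inl ⟨rfl, d00 z hz hz'⟩
    · intro z hz hz'; exact Or.inr ⟨rfl, d10 z hz hz'⟩
  · exact ht
  · exact hs
  · rintro z (h | ⟨i, hi⟩)
    · rcases Fin.exists_fin_two.1 h with h | h
      · exact e1 z (Or.inl h)
      · exact e1 z (Or.inr (Or.inr h))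
    · exact e1 z (Or.inr (Or.inl hi))
  · rintro z (h | ⟨i, hi⟩)
    · rcases Fin.exists_fin_two.1 h with h | h
      · exact e2 z (Or.inl h)
      · exact e2 z (Or.inr (Or.inr h))
    · exact e2 z (Or.inr (Or.inl hi))

theorem forall_three {P : Fin 3 → Prop} (h0 : P 0) (h1 : P 1) (h2 : P 2) : ∀ i, P i := by
  intro i; fin_cases i <;> assumption

theorem exists_three {P : Fin 3 → Prop} (h : ∃ i, P i) : P 0 ∨ P 1 ∨ P 2 := by
  obtain ⟨i, hi⟩ := h
  fin_cases i
  · exact Or.inl hi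
  · exact Or.inr (Or.inl hi)
  · exact Or.inr (Or.inr hi)

theorem alt3 {E : V → V → Prop} {b : ℕ} {p q ps qs s0 t0 s1 t1 s2 t2 : V}
    {l0 l0' l1 l1' l2 : List V}
    (h0 : DP E s0 t0 l0) (h0' : DP E s1 t0 l0') (h1 : DP E s1 t1 l1)
    (h1' : DP E s2 t1 l1') (h2 : DP E s2 t2 l2)
    (hl0 : b + 1 ≤ l0'.length) (hl1' : b + 1 ≤ l1'.length) (hl1 : b + 1 ≤ l1.length)
    (d01 : ∀ z ∈ l0, z ∉ l1) (d02 : ∀ z ∈ l0, z ∉ l2) (d12 : ∀ z ∈ l1, z ∉ l2)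
    (dd : ∀ z ∈ l0', z ∉ l1')
    (d00 : ∀ z ∈ l0, z ∈ l0' → z = t0) (d00' : ∀ z ∈ l0, z ∉ l1')
    (d10 : ∀ z ∈ l1, z ∈ l0' → z = s1) (d11 : ∀ z ∈ l1, z ∈ l1' → z = t1)
    (d20 : ∀ z ∈ l2, z ∉ l0') (d21 : ∀ z ∈ l2, z ∈ l1' → z = s2)
    (ht : t2 = p ∨ t2 = q) (hs : s0 = ps ∨ s0 = qs)
    (e1 : ∀ z, z ∈ l0 ∨ z ∈ l0' ∨ z ∈ l1 ∨ z ∈ l1' ∨ z ∈ l2 → z = p ∨ z = q → z = t2)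
    (e2 : ∀ z, z ∈ l0 ∨ z ∈ l0' ∨ z ∈ l1 ∨ z ∈ l1' ∨ z ∈ l2 → z = ps ∨ z = qs → z = s0) :
    Concl E b p q ps qs := by
  have key : ∀ R : Set V, (∀ z ∈ R, z ∈ l0 ∨ z ∈ l0' ∨ z ∈ l1 ∨ z ∈ l1' ∨ z ∈ l2) →
      (∀ z ∈ R, z = p ∨ z = q → z = t2) ∧ (∀ z ∈ R, z = ps ∨ z = qs → z = s0) :=
    fun R h => ⟨fun z hz => e1 z (h z hz), fun z hz => e2 z (h z hz)⟩
  refine ⟨3, by norm_num, by norm_num, ⟨![s0, s1, s2], ![t0, t1, t2], ![l0, l1, l2],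
    ![l0', l1'],
    ?_, ?_, ?_, ?_, ?_, ?_, ?_, ?_, ?_, ?_, ?_⟩,
    ?_, ?_, key _ ?_⟩
  · exact forall_three h0.1 h1.1 h2.1
  · exact forall_three h0.2.1 h1.2.1 h2.2.1
  · exact forall_three h0.2.2 h1.2.2 h2.2.2
  · exact Fin.forall_fin_two.2 ⟨h0'.1, h1'.1⟩
  · exact Fin.forall_fin_two.2 ⟨h0'.2.1, h1'.2.1⟩
  · exact Fin.forall_fin_two.2 ⟨h0'.2.2, h1'.2.2⟩
  · refine forall_three ?_ ?_ ?_
    · intro h; exact absurd h (by decide)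
    · intro _ _; exact hl1
    · intro _ h; exact absurd h (by decide)
  · exact Fin.forall_fin_two.2 ⟨hl0, hl1'⟩
  · refine forall_three (forall_three ?_ ?_ ?_) (forall_three ?_ ?_ ?_) (forall_three ?_ ?_ ?_)
    · intro h; exact absurd rfl h
    · intro _; exact d01
    · intro _; exact d02
    · intro _ z hz hz'; exact d01 z hz' hz
    · intro h; exact absurd rfl h
    · intro _; exact d12
    · intro _ z hz hz'; exact d02 z hz' hz
    · intro _ z hz hz'; exact d12 z hz' hz
    · intro h; exact absurd rfl h
  · refine Fin.forall_fin_two.2 ⟨Fin.forall_fin_two.2 ⟨?_, ?_⟩, Fin.forall_fin_two.2 ⟨?_, ?_⟩⟩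
    · intro h; exact absurd rfl h
    · intro _; exact dd
    · intro _ z hz hz'; exact dd z hz' hz
    · intro h; exact absurd rfl h
  · refine forall_three (Fin.forall_fin_two.2 ⟨?_, ?_⟩) (Fin.forall_fin_two.2 ⟨?_, ?_⟩)
      (Fin.forall_fin_two.2 ⟨?_, ?_⟩)
    · intro z hz hz'; exact Or.inl ⟨rfl, d00 z hz hz'⟩
    · intro z hz hz'; exact absurd hz' (d00' z hz)
    · intro z hz hz'; exact Or.inr ⟨rfl, d10 z hz hz'⟩
    · intro z hz hz'; exact Or.inl ⟨rfl, d11 z hz hz'⟩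
    · intro z hz hz'; exact absurd hz' (d20 z hz)
    · intro z hz hz'; exact Or.inr ⟨rfl, d21 z hz hz'⟩
  · exact ht
  · exact hs
  · rintro z (h | h)
    · rcases exists_three h with h | h | h
      · exact Or.inl h
      · exact Or.inr (Or.inr (Or.inl h))
      · exact Or.inr (Or.inr (Or.inr (Or.inr h)))
    · rcases Fin.exists_fin_two.1 h with h | h
      · exact Or.inr (Or.inl h)
      · exact Or.inr (Or.inr (Or.inr (Or.inl h)))

/-- Forward continuation from `x` inside the gadget. -/
def Fwd (E : V → V → Prop) (b : ℕ) (VG : Set V) (p q x : V) : Prop :=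
  (∃ t A, (t = p ∨ t = q) ∧ DP E x t A ∧ (∀ z ∈ A, z ∈ VG) ∧
    ∀ z ∈ A, z = p ∨ z = q → z = t) ∨
  (∃ t r A B, (t = p ∨ t = q) ∧ DP E x r A ∧ DP E t r B ∧ b + 1 ≤ A.length ∧
    b + 1 ≤ B.length ∧ (∀ z ∈ A, z ∈ VG) ∧ (∀ z ∈ B, z ∈ VG) ∧
    (∀ z ∈ A, z ∈ B → z = r) ∧
    (∀ z ∈ A, z = p ∨ z = q → z = t) ∧ (∀ z ∈ B, z = p ∨ z = q → z = t))

/-- Backward continuation from `x` inside the gadget. -/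
def Bwd (E : V → V → Prop) (b : ℕ) (VG : Set V) (p q x : V) : Prop :=
  ∃ s t A C, (t = p ∨ t = q) ∧ DP E s x A ∧ DP E s t C ∧ b ≤ A.length ∧
    (∀ z ∈ A, z ∈ VG) ∧ (∀ z ∈ C, z ∈ VG) ∧
    (∀ z ∈ A, z ∈ C → z = s) ∧
    (∀ z ∈ A, z = p ∨ z = q → z = t) ∧ (∀ z ∈ C, z = p ∨ z = q → z = t)

theorem lemB {E : V → V → Prop} {b : ℕ} {VG : Set V} {p q ps qs x e : V} {T : List V}
    (hps : ps ∉ VG) (hqs : qs ∉ VG) (hp : p ∈ VG) (hq : q ∈ VG) (hx : x ∈ VG)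
    (hB : Bwd E b VG p q x) (he : e = ps ∨ e = qs) (hT : DP E x e T)
    (hTV : ∀ z ∈ T, z ∈ VG → z = x) (hTe : ∀ z ∈ T, z = ps ∨ z = qs → z = e) :
    Concl E b p q ps qs := by
  obtain ⟨s, t, A, C, ht, hA, hC, hlen, hAV, hCV, hAC, hAt, hCt⟩ := hB
  have heV : e ∉ VG := by rcases he with rfl | rfl <;> assumption
  have hxe : x ≠ e := fun h => heV (h ▸ hx)
  have hT2 := hT.length_of_ne hxe
  have hd : ∀ z ∈ A, z ∈ T → z = x := fun z hz hz' => hTV z hz' (hAV z hz)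
  have hm := mem_append_tail hA hT
  have hl := length_append_tail hA hT
  have hxA := hA.last_mem
  refine alt2 (DP.single E e) (hA.append hT hd) hC (by omega) ?_ ?_ ?_ ht he ?_ ?_
  all_goals try simp only [hm, List.mem_singleton]
  · grind
  · grind
  · grind
  · grind
  · grind

theorem lemF {E : V → V → Prop} {b : ℕ} (hb : 1 ≤ b) {VG : Set V} {p q ps qs x e s : V}
    {T M : List V}
    (hps : ps ∉ VG) (hqs : qs ∉ VG) (hp : p ∈ VG) (hq : q ∈ VG) (hx : x ∈ VG)
    (hF : Fwd E b VG p q x) (he : e = ps ∨ e = qs) (hT : DP E s e T)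
    (hTl : b + 1 ≤ T.length)
    (hM : DP E s x M) (hTM : ∀ z ∈ T, z ∈ M → z = s) (hMV : ∀ z ∈ M, z ∈ VG → z = x)
    (hMe : ∀ z ∈ M, z ≠ ps ∧ z ≠ qs)
    (hTV : ∀ z ∈ T, z ∈ VG → z = s) (hTe : ∀ z ∈ T, z = ps ∨ z = qs → z = e) :
    Concl E b p q ps qs := by
  have heV : e ∉ VG := by rcases he with rfl | rfl <;> assumption
  have hsM := hM.first_mem
  have heT := hT.last_mem
  have heM : e ∉ M := fun h => by
    rcases he with rfl | rfl
    · exact (hMe _ h).1 rfl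
    · exact (hMe _ h).2 rfl
  rcases hF with ⟨t, A, ht, hA, hAV, hAt⟩ | ⟨t, r, A, B, ht, hA, hB, hAl, hBl, hAV, hBV, hAB, hAt, hBt⟩
  · have hxA := hA.first_mem
    have hd : ∀ z ∈ M, z ∈ A → z = x := fun z hz hz' => hMV z hz (hAV z hz')
    have hm := mem_append_tail hM hA
    refine alt2 (DP.single E e) hT (hM.append hA hd) hTl ?_ ?_ ?_ ht he ?_ ?_
    all_goals try simp only [hm, List.mem_singleton]
    all_goals grind
  · have hxA := hA.first_mem
    have htB := hB.first_mem
    have hxr := hA.ne_of_length (by omega)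
    have htr := hB.ne_of_length (by omega)
    have hd : ∀ z ∈ M, z ∈ A → z = x := fun z hz hz' => hMV z hz (hAV z hz')
    have hm := mem_append_tail hM hA
    have hl := length_append_tail hM hA
    have hMl := hM.length_pos
    refine alt3 (DP.single E e) hT (hM.append hA hd) hB (DP.single E t) hTl hBl (by omega)
      ?_ ?_ ?_ ?_ ?_ ?_ ?_ ?_ ?_ ?_ ht he ?_ ?_
    all_goals try simp only [hm, List.mem_singleton]
    all_goals grind

theorem lemP {E : V → V → Prop} {b : ℕ} (hb : 1 ≤ b) {VG : Set V} {p q ps qs x : V}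
    {M : List V}
    (hps : ps ∉ VG) (hqs : qs ∉ VG) (hp : p ∈ VG) (hq : q ∈ VG) (hx : x ∈ VG)
    (hF : Fwd E b VG p q x)
    (hM : DP E ps x M) (hMV : ∀ z ∈ M, z ∈ VG → z = x)
    (hMe : ∀ z ∈ M, z = ps ∨ z = qs → z = ps) :
    Concl E b p q ps qs := by
  have hsM := hM.first_mem
  rcases hF with ⟨t, A, ht, hA, hAV, hAt⟩ | ⟨t, r, A, B, ht, hA, hB, hAl, hBl, hAV, hBV, hAB, hAt, hBt⟩
  · have hxA := hA.first_mem
    have hd : ∀ z ∈ M, z ∈ A → z = x := fun z hz hz' => hMV z hz (hAV z hz')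
    have hm := mem_append_tail hM hA
    refine alt1 (hM.append hA hd) ht (Or.inl rfl) ?_ ?_
    all_goals try simp only [hm]
    all_goals grind
  · have hxA := hA.first_mem
    have htB := hB.first_mem
    have hxr := hA.ne_of_length (by omega)
    have htr := hB.ne_of_length (by omega)
    have hd : ∀ z ∈ M, z ∈ A → z = x := fun z hz hz' => hMV z hz (hAV z hz')
    have hm := mem_append_tail hM hA
    refine alt2 (hM.append hA hd) hB (DP.single E t) hBl ?_ ?_ ?_ ht (Or.inl rfl) ?_ ?_
    all_goals try simp only [hm, List.mem_singleton]
    all_goals grind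

/-- `f 0, …, f n` is a dipath. -/
def PF (E : V → V → Prop) (f : ℕ → V) (n : ℕ) : Prop :=
  (∀ k, k < n → E (f k) (f (k + 1))) ∧ (∀ i j, i ≤ n → j ≤ n → f i = f j → i = j)

/-- The segment `f i, …, f j`. -/
def seg (f : ℕ → V) (i j : ℕ) : List V := (List.range' i (j + 1 - i)).map f

theorem mem_seg {f : ℕ → V} {i j : ℕ} {z : V} :
    z ∈ seg f i j ↔ ∃ k, i ≤ k ∧ k ≤ j ∧ f k = z := by
  simp only [seg, List.mem_map, List.mem_range'_1]
  constructor
  · rintro ⟨k, hk, rfl⟩; exact ⟨k, by omega, by omega, rfl⟩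
  · rintro ⟨k, h1, h2, rfl⟩; exact ⟨k, by omega, rfl⟩

theorem length_seg (f : ℕ → V) (i j : ℕ) : (seg f i j).length = j + 1 - i := by
  simp [seg]

theorem PF.seg {E : V → V → Prop} {f : ℕ → V} {n : ℕ} (h : PF E f n) {i j : ℕ}
    (hij : i ≤ j) (hj : j ≤ n) : DP E (f i) (f j) (seg f i j) := by
  induction j, hij using Nat.le_induction with
  | base =>
    have : Paper.seg f i i = [f i] := by simp [Paper.seg]
    rw [this]; exact DP.single E _
  | succ j hij ih =>
    have e : Paper.seg f i (j + 1) = Paper.seg f i j ++ [f (j + 1)] := by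
      unfold Paper.seg
      have : j + 1 + 1 - i = (j + 1 - i) + 1 := by omega
      rw [this, List.range'_concat]
      simp
      congr 1; omega
    rw [e]
    refine (ih (by omega)).snoc (h.1 j (by omega)) ?_
    rw [mem_seg]
    rintro ⟨k, h1, h2, h3⟩
    have := h.2 k (j + 1) (by omega) hj h3
    omega

theorem of_list {E : V → V → Prop} {l : List V} {u v : V} (hn : l.Nodup)
    (hE : ∀ x y, adjIn l x y → E x y) (hu : l.head? = some u) (hv : l.getLast? = some v) :
    ∃ f : ℕ → V, PF E f (l.length - 1) ∧ f 0 = u ∧ f (l.length - 1) = v ∧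
      (∀ z, z ∈ l ↔ ∃ k ≤ l.length - 1, f k = z) ∧ (∀ y, l[1]? = some y → f 1 = y) := by
  have hpos : 0 < l.length := List.length_pos_of_mem (List.mem_of_head? hu)
  have hf : ∀ k (hk : k < l.length), l.getD k u = l[k] := by
    intro k hk; simp [List.getD, hk]
  refine ⟨fun k => l.getD k u, ⟨?_, ?_⟩, ?_, ?_, ?_, ?_⟩
  · intro k hk
    simp only []
    rw [hf k (by omega), hf (k + 1) (by omega)]
    apply hE
    refine ⟨l.take k, l.drop (k + 2), ?_⟩
    rw [← List.drop_eq_getElem_cons, ← List.drop_eq_getElem_cons, List.take_append_drop]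
  · intro i j hi hj h
    simp only [] at h
    rw [hf i (by omega), hf j (by omega)] at h
    exact (List.Nodup.getElem_inj_iff hn).1 h
  · cases l with
    | nil => simp at hu
    | cons a l => simpa using hu
  · rw [List.getLast?_eq_getElem?] at hv
    simp only []
    simp [List.getD, hv]
  · intro z
    rw [List.mem_iff_getElem]
    constructor
    · rintro ⟨k, hk, rfl⟩
      exact ⟨k, by omega, hf k hk⟩
    · rintro ⟨k, hk, rfl⟩
      exact ⟨k, by omega, (hf k (by omega)).symm⟩
  · intro y hy
    simp [List.getD, hy]

theorem main_abs [Fintype V] {E : V → V → Prop} {b : ℕ} (hb : 1 ≤ b) {VG : Set V} {p q qs : V}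
    {g : ℕ → V} {R n : ℕ} (hg : PF E g n) (hRb : b ≤ R) (hn : R + (2 * b ^ 2 + b - 2) ≤ n)
    (htoq : ∀ k, R ≤ k → k ≤ n → E (g k) qs) (hqg : ∀ k, k ≤ n → g k ≠ qs)
    (extra : E (g 0) (g (R + 1)) ∨ ∃ w, R < w ∧ w ≤ n ∧ E (g w) (g 0))
    (hp : p ∈ VG) (hq : q ∈ VG) (hps : g n ∉ VG) (hqs : qs ∉ VG)
    (hmeet : ∃ k, k ≤ n ∧ g k ∈ VG)
    (hFB : ∀ x ∈ VG, Fwd E b VG p q x ∨ Bwd E b VG p q x)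
    (hcard : ∀ S : Finset V, (∀ x ∈ S, x ∈ VG) → 2 * b + 1 ≤ S.card →
      ∃ x ∈ S, Bwd E b VG p q x) :
    Concl E b p q (g n) qs := by
  classical
  have hbb : b ≤ b ^ 2 := by nlinarith
  have hRn : R + 1 ≤ n := by omega
  have inj := hg.2
  -- the case of a backward continuation on the final part
  by_cases hB0 : ∃ k, R ≤ k ∧ k ≤ n ∧ g k ∈ VG ∧ Bwd E b VG p q (g k)
  · obtain ⟨k, hk1, hk2, hkV, hB⟩ := hB0
    have hT : DP E (g k) qs [g k, qs] :=
      (DP.single E qs).cons (htoq k hk1 hk2) (by simpa using hqg k hk2)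
    refine lemB hps hqs hp hq hkV hB (Or.inr rfl) hT ?_ ?_
    all_goals simp only [List.mem_cons, List.not_mem_nil, or_false]
    all_goals grind
  -- the basic principle
  have lemK : ∀ x e T, x ∈ VG → (e = g n ∨ e = qs) → DP E x e T → b + 1 ≤ T.length →
      (∀ z ∈ T, z ∈ VG → z = x) → (∀ z ∈ T, z = g n ∨ z = qs → z = e) →
      Concl E b p q (g n) qs := by
    intro x e T hx he hT hl hTV hTe
    rcases hFB x hx with hF | hB
    · refine lemF hb hps hqs hp hq hx hF he hT hl (DP.single E x) ?_ ?_ ?_ hTV hTe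
      all_goals simp only [List.mem_singleton]
      all_goals grind
    · exact lemB hps hqs hp hq hx hB he hT hTV hTe
  have hFw : ∀ k, R ≤ k → k ≤ n → g k ∈ VG → Fwd E b VG p q (g k) := by
    intro k h1 h2 h3
    rcases hFB _ h3 with h | h
    · exact h
    · exact absurd ⟨k, h1, h2, h3, h⟩ hB0
  by_cases hP2 : ∃ k, k ≤ R ∧ g k ∈ VG
  · -- some vertex of the initial path lies in the gadget
    by_cases hj : ∃ i j, R ≤ j ∧ j < n ∧ i + b ≤ j + 1 ∧ i ≤ j ∧ g i ∈ VG ∧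
        ∀ k, i < k → k ≤ j → g k ∉ VG
    · obtain ⟨i, j, h1, h2, h3, h4, h5, h6⟩ := hj
      have hT := (hg.seg h4 h2.le).snoc (htoq j h1 h2.le) (by
        rw [mem_seg]; rintro ⟨k, _, hk, e⟩; exact hqg k (by omega) e)
      refine lemK _ _ _ h5 (Or.inr rfl) hT (by simp [length_seg]; omega) ?_ ?_
      · intro z hz hzV
        rw [List.mem_append, mem_seg] at hz
        rcases hz with ⟨k, hk1, hk2, rfl⟩ | hz
        · by_cases hik : i = k
          · rw [hik]
          · exact absurd hzV (h6 k (by omega) hk2)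
        · simp at hz; subst hz; exact absurd hzV hqs
      · intro z hz hzV
        rw [List.mem_append, mem_seg] at hz
        rcases hz with ⟨k, hk1, hk2, rfl⟩ | hz
        · rcases hzV with h | h
          · have := inj k n (by omega) le_rfl h; omega
          · exact h
        · simpa using hz
    · exfalso
      obtain ⟨k0, hk0, hk0V⟩ := hP2
      -- maximal index at most `R`
      have hmax : ∀ j, k0 ≤ j → ∃ i, i ≤ j ∧ g i ∈ VG ∧ ∀ k, i < k → k ≤ j → g k ∉ VG := by
        intro j hj
        induction j, hj using Nat.le_induction with
        | base => exact ⟨k0, le_rfl, hk0V, fun k _ _ => by omega⟩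
        | succ j hj ih =>
          by_cases h : g (j + 1) ∈ VG
          · exact ⟨j + 1, le_rfl, h, fun k _ _ => by omega⟩
          · obtain ⟨i, h1, h2, h3⟩ := ih
            refine ⟨i, by omega, h2, fun k hk hk' => ?_⟩
            by_cases e : k = j + 1
            · rw [e]; exact h
            · exact h3 k hk (by omega)
      obtain ⟨v0, hv1, hv2, hv3⟩ := hmax R hk0
      set I : Finset ℕ := (Finset.Ioc R n).filter (fun k => g k ∈ VG) with hI
      have hcov : Finset.Ico R n ⊆ (insert v0 I).biUnion (fun i => Finset.Ico i (i + (b - 1))) := by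
        intro j hjm
        rw [Finset.mem_Ico] at hjm
        obtain ⟨i, h1, h2, h3⟩ := hmax j (by omega)
        rw [Finset.mem_biUnion]
        refine ⟨i, ?_, ?_⟩
        · rw [Finset.mem_insert]
          by_cases hiR : i ≤ R
          · left
            by_contra hne
            rcases Nat.lt_or_gt_of_ne hne with h | h
            · exact h3 v0 h (by omega) hv2
            · exact hv3 i h hiR h2
          · right
            rw [hI, Finset.mem_filter, Finset.mem_Ioc]
            exact ⟨by omega, h2⟩
        · rw [Finset.mem_Ico]
          refine ⟨h1, ?_⟩
          by_contra hc
          exact hj ⟨i, j, hjm.1, hjm.2, by omega, h1, h2, h3⟩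
      have hc1 := (Finset.card_le_card hcov).trans
        (Finset.card_biUnion_le_card_mul _ _ (b - 1) (fun i _ => by simp))
      have hc2 : (insert v0 I).card ≤ I.card + 1 := Finset.card_insert_le _ _
      rw [Nat.card_Ico] at hc1
      have hc3 : 2 * b + 1 ≤ I.card := by
        by_contra hlt
        have h1 : (insert v0 I).card ≤ 2 * b + 1 := by omega
        have h2 : n - R ≤ (2 * b + 1) * (b - 1) := hc1.trans (Nat.mul_le_mul_right _ h1)
        obtain ⟨c, rfl⟩ : ∃ c, b = c + 1 := ⟨b - 1, by omega⟩
        have h3 : 2 * (c + 1) ^ 2 + (c + 1) - 2 ≤ (2 * (c + 1) + 1) * c := by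
          have : c + 1 - 1 = c := rfl
          rw [this] at h2
          omega
        have h4 : 2 * (c + 1) ^ 2 + (c + 1) ≤ (2 * (c + 1) + 1) * c + 2 := by omega
        nlinarith
      have hS := hcard (I.image g) (by
        intro x hx
        rw [Finset.mem_image] at hx
        obtain ⟨k, hk, rfl⟩ := hx
        exact (Finset.mem_filter.1 hk).2) (by
        rw [Finset.card_image_of_injOn]
        · exact hc3
        · intro i hi j hj h
          have h1 := Finset.mem_Ioc.1 (Finset.mem_filter.1 hi).1
          have h2 := Finset.mem_Ioc.1 (Finset.mem_filter.1 hj).1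
          exact inj i j h1.2 h2.2 h)
      obtain ⟨x, hx, hB⟩ := hS
      rw [Finset.mem_image] at hx
      obtain ⟨k, hk, rfl⟩ := hx
      have h1 := Finset.mem_Ioc.1 (Finset.mem_filter.1 hk).1
      exact hB0 ⟨k, by omega, h1.2, (Finset.mem_filter.1 hk).2, hB⟩
  · -- no vertex of the initial path lies in the gadget
    have hP2' : ∀ k, k ≤ R → g k ∉ VG := fun k hk h => hP2 ⟨k, hk, h⟩
    have hex : ∃ k, k ≤ n ∧ g k ∈ VG := hmeet
    obtain ⟨x1, ⟨hx1n, hx1V⟩, hx1min⟩ : ∃ k, (k ≤ n ∧ g k ∈ VG) ∧ ∀ j, j < k → g j ∉ VG :=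
      ⟨Nat.find hex, Nat.find_spec hex, fun j hj h =>
        Nat.find_min hex hj ⟨by have := (Nat.find_spec hex).1; omega, h⟩⟩
    have hx1R : R < x1 := by
      by_contra h; exact hP2' x1 (by omega) hx1V
    have hx1n' : x1 < n := by
      rcases Nat.lt_or_ge x1 n with h | h
      · exact h
      · have : x1 = n := by omega
        subst this; exact absurd hx1V hps
    have hF1 := hFw x1 hx1R.le hx1n hx1V
    have hqseg : ∀ i j, j ≤ n → qs ∉ seg g i j := by
      intro i j hj h
      rw [mem_seg] at h
      obtain ⟨k, _, hk, e⟩ := h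
      exact hqg k (by omega) e
    have hP2T : DP E (g 0) qs (seg g 0 R ++ [qs]) :=
      (hg.seg (Nat.zero_le R) (by omega)).snoc (htoq R le_rfl (by omega)) (hqseg _ _ (by omega))
    rcases extra with hE | ⟨w, hRw, hwn, hE⟩
    · have hM : DP E (g 0) (g x1) (g 0 :: seg g (R + 1) x1) := by
        refine (hg.seg (by omega) hx1n).cons hE ?_
        rw [mem_seg]; rintro ⟨k, h1, h2, h3⟩
        have := inj k 0 (by omega) (by omega) h3; omega
      refine lemF hb hps hqs hp hq hx1V hF1 (Or.inr rfl) hP2T (by simp [length_seg]; omega)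
        hM ?_ ?_ ?_ ?_ ?_
      all_goals intro z hz
      all_goals simp only [List.mem_append, List.mem_cons, mem_seg, List.not_mem_nil, or_false] at hz ⊢
      · rintro (h | ⟨k, h1, h2, rfl⟩)
        · exact h
        · rcases hz with ⟨k', h1', h2', h3'⟩ | hz
          · have := inj k' k (by omega) (by omega) h3'; omega
          · exact absurd hz (hqg k (by omega))
      · intro hV
        rcases hz with rfl | ⟨k, h1, h2, rfl⟩
        · exact absurd hV (hP2' 0 (by omega))
        · by_cases e : k = x1
          · rw [e]
          · exact absurd hV (hx1min k (by omega))
      · rcases hz with rfl | ⟨k, h1, h2, rfl⟩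
        · exact ⟨fun h => by have := inj 0 n (by omega) le_rfl h; omega, hqg 0 (by omega)⟩
        · exact ⟨fun h => by have := inj k n (by omega) le_rfl h; omega, hqg k (by omega)⟩
      · intro hV
        rcases hz with ⟨k, h1, h2, rfl⟩ | rfl
        · exact absurd hV (hP2' k h2)
        · exact absurd hV hqs
      · rcases hz with ⟨k, h1, h2, rfl⟩ | rfl
        · rintro (h | h)
          · have := inj k n (by omega) le_rfl h; omega
          · exact h
        · intro _; rfl
    · have hwT : DP E (g w) qs (g w :: (seg g 0 R ++ [qs])) := by
        refine hP2T.cons hE ?_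
        simp only [List.mem_append, List.mem_cons, mem_seg, List.not_mem_nil, or_false]
        rintro (⟨k, h1, h2, h3⟩ | h)
        · have := inj k w (by omega) (by omega) h3; omega
        · exact hqg w hwn h
      by_cases hwx : w < x1
      · refine lemF hb hps hqs hp hq hx1V hF1 (Or.inr rfl) hwT (by simp [length_seg]; omega)
          (hg.seg hwx.le hx1n) ?_ ?_ ?_ ?_ ?_
        all_goals intro z hz
        all_goals simp only [List.mem_append, List.mem_cons, mem_seg, List.not_mem_nil, or_false] at hz ⊢
        · rintro ⟨k, h1, h2, rfl⟩
          rcases hz with hz | ⟨k', h1', h2', h3'⟩ | hz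
          · exact hz
          · have := inj k' k (by omega) (by omega) h3'; omega
          · exact absurd hz (hqg k (by omega))
        · intro hV
          rcases hz with ⟨k, h1, h2, rfl⟩
          by_cases e : k = x1
          · rw [e]
          · exact absurd hV (hx1min k (by omega))
        · rcases hz with ⟨k, h1, h2, rfl⟩
          exact ⟨fun h => by have := inj k n (by omega) le_rfl h; omega, hqg k (by omega)⟩
        · intro hV
          rcases hz with rfl | ⟨k, h1, h2, rfl⟩ | rfl
          · rfl
          · exact absurd hV (hP2' k h2)
          · exact absurd hV hqs
        · rcases hz with rfl | ⟨k, h1, h2, rfl⟩ | rfl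
          · rintro (h | h)
            · have := inj w n (by omega) le_rfl h; omega
            · exact h
          · rintro (h | h)
            · have := inj k n (by omega) le_rfl h; omega
            · exact h
          · intro _; rfl
      · by_cases hwn' : w = n
        · subst hwn'
          have hM : DP E (g w) (g x1) (g w :: seg g 0 x1) := by
            refine (hg.seg (by omega) hx1n).cons hE ?_
            rw [mem_seg]; rintro ⟨k, h1, h2, h3⟩
            have := inj k w (by omega) (by omega) h3; omega
          refine lemP hb hps hqs hp hq hx1V hF1 hM ?_ ?_
          all_goals intro z hz
          all_goals simp only [List.mem_cons, mem_seg] at hz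
          · intro hV
            rcases hz with rfl | ⟨k, h1, h2, rfl⟩
            · exact absurd hV hps
            · by_cases e : k = x1
              · rw [e]
              · exact absurd hV (hx1min k (by omega))
          · rcases hz with rfl | ⟨k, h1, h2, rfl⟩
            · intro _; rfl
            · rintro (h | h)
              · exact h
              · exact absurd h (hqg k (by omega))
        · -- last gadget vertex up to `w`
          have hmax : ∀ j, x1 ≤ j → ∃ i, x1 ≤ i ∧ i ≤ j ∧ g i ∈ VG ∧
              ∀ k, i < k → k ≤ j → g k ∉ VG := by
            intro j hj
            induction j, hj using Nat.le_induction with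
            | base => exact ⟨x1, le_rfl, le_rfl, hx1V, fun k _ _ => by omega⟩
            | succ j hj ih =>
              by_cases h : g (j + 1) ∈ VG
              · exact ⟨j + 1, by omega, le_rfl, h, fun k _ _ => by omega⟩
              · obtain ⟨i, h0, h1, h2, h3⟩ := ih
                refine ⟨i, h0, by omega, h2, fun k hk hk' => ?_⟩
                by_cases e : k = j + 1
                · rw [e]; exact h
                · exact h3 k hk (by omega)
          obtain ⟨u, hu0, hu1, hu2, hu3⟩ := hmax w (by omega)
          have hA := hg.seg hu1 hwn
          have hT := hA.append hwT (by
            intro z hz hz'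
            simp only [List.mem_append, List.mem_cons, mem_seg, List.not_mem_nil, or_false] at hz hz'
            obtain ⟨k, h1, h2, rfl⟩ := hz
            rcases hz' with h | ⟨k', h1', h2', h3'⟩ | h
            · exact h
            · have := inj k' k (by omega) (by omega) h3'; omega
            · exact absurd h (hqg k (by omega)))
          have hl := length_append_tail hA hwT
          have hm := mem_append_tail hA hwT
          refine lemK _ _ _ hu2 (Or.inr rfl) hT ?_ ?_ ?_
          · simp [length_seg]; omega
          all_goals intro z hz
          all_goals rw [hm] at hz
          all_goals simp only [List.mem_append, List.mem_cons, mem_seg, List.not_mem_nil, or_false] at hz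
          · have hz' : (∃ k, u ≤ k ∧ k ≤ w ∧ g k = z) ∨ (∃ k, 0 ≤ k ∧ k ≤ R ∧ g k = z) ∨ z = qs := by
              rcases hz with h | h | h | h
              · exact Or.inl h
              · exact Or.inl ⟨w, hu1, le_rfl, h.symm⟩
              · exact Or.inr (Or.inl h)
              · exact Or.inr (Or.inr h)
            intro hV
            rcases hz' with ⟨k, h1, h2, rfl⟩ | ⟨k, h1, h2, rfl⟩ | rfl
            · by_cases e : k = u
              · rw [e]
              · exact absurd hV (hu3 k (by omega) h2)
            · exact absurd hV (hP2' k h2)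
            · exact absurd hV hqs
          · have hz' : (∃ k, k ≤ w ∧ g k = z) ∨ z = qs := by
              rcases hz with ⟨k, _, h, h'⟩ | h | ⟨k, _, h, h'⟩ | h
              · exact Or.inl ⟨k, h, h'⟩
              · exact Or.inl ⟨w, le_rfl, h.symm⟩
              · exact Or.inl ⟨k, by omega, h'⟩
              · exact Or.inr h
            rcases hz' with ⟨k, h2, rfl⟩ | rfl
            · rintro (h | h)
              · have := inj k n (by omega) le_rfl h; omega
              · exact h
            · intro _; rfl

/-- The two properties of gadgets that are used. -/
def GProp (E : V → V → Prop) (b : ℕ) (VG : Set V) (p q : V) : Prop :=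
  (∀ x ∈ VG, Fwd E b VG p q x ∨ Bwd E b VG p q x) ∧
  (∀ S : Finset V, (∀ x ∈ S, x ∈ VG) → 2 * b + 1 ≤ S.card → ∃ x ∈ S, Bwd E b VG p q x)

theorem gprop_of_exc {E : V → V → Prop} {b : ℕ} {VG : Set V} {p q : V} (T : Finset V)
    (hT : T.card ≤ 2 * b) (h1 : ∀ x ∈ VG, Fwd E b VG p q x ∨ Bwd E b VG p q x)
    (h2 : ∀ x ∈ VG, x ∉ T → Bwd E b VG p q x) : GProp E b VG p q := by
  refine ⟨h1, fun S hS hc => ?_⟩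
  by_contra hcon
  push Not at hcon
  have : S ⊆ T := by
    intro x hx
    by_contra hxT
    exact hcon x hx (h2 x (hS x hx) hxT)
  have := Finset.card_le_card this
  omega

theorem fwd_self {E : V → V → Prop} {b : ℕ} {VG : Set V} {p q x : V} (hx : x = p ∨ x = q)
    (hV : x ∈ VG) : Fwd E b VG p q x :=
  Or.inl ⟨x, [x], hx, DP.single E x, by simpa using hV, by simp⟩

theorem gprop_triv {E : V → V → Prop} {b : ℕ} (hb : 1 ≤ b) {VG : Set V} {p q : V}
    (hV : ∀ x, x ∈ VG ↔ x = p ∨ x = q) : GProp E b VG p q := by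
  classical
  refine gprop_of_exc {p, q} (Finset.card_le_two.trans (by omega))
    (fun x hx => Or.inl (fwd_self ((hV x).1 hx) hx)) ?_
  intro x hx hx'
  exact absurd ((hV x).1 hx) (by simpa using hx')

theorem gprop_I {E : V → V → Prop} {b : ℕ} (hb : 1 ≤ b) {VG : Set V} {p q : V}
    {c : ℕ → V} {m : ℕ} (hc : PF E c m) (h0 : c 0 = q) (hm : c m = p) (hm1 : 1 ≤ m)
    (hV : ∀ x, x ∈ VG ↔ ∃ k ≤ m, c k = x) : GProp E b VG p q := by
  classical
  have hF : ∀ x ∈ VG, Fwd E b VG p q x := by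
    intro x hx
    obtain ⟨k, hk, rfl⟩ := (hV x).1 hx
    by_cases hk0 : k = 0
    · subst hk0; exact fwd_self (Or.inr h0) hx
    · refine Or.inl ⟨c m, seg c k m, Or.inl hm, hc.seg hk le_rfl, ?_, ?_⟩
      · intro z hz
        obtain ⟨j, h1, h2, h3⟩ := mem_seg.1 hz
        exact (hV z).2 ⟨j, h2, h3⟩
      · intro z hz hz'
        obtain ⟨j, h1, h2, rfl⟩ := mem_seg.1 hz
        rcases hz' with h | h
        · rw [h, hm]
        · have := hc.2 j 0 (by omega) (by omega) (h.trans h0.symm); omega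
  refine gprop_of_exc (insert p ((Finset.range (b - 1)).image c)) ?_
    (fun x hx => Or.inl (hF x hx)) ?_
  · have h1 := Finset.card_insert_le p ((Finset.range (b - 1)).image c)
    have h2 := Finset.card_image_le (s := Finset.range (b - 1)) (f := c)
    rw [Finset.card_range] at h2
    omega
  · intro x hx hx'
    obtain ⟨k, hk, rfl⟩ := (hV x).1 hx
    simp only [Finset.mem_insert, Finset.mem_image, Finset.mem_range, not_or, not_exists,
      not_and] at hx'
    have hkb : b - 1 ≤ k := by
      by_contra h; exact hx'.2 k (by omega) rfl
    have hkm : k ≠ m := fun e => hx'.1 (e ▸ hm)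
    refine ⟨c 0, c 0, seg c 0 k, [c 0], Or.inr h0, hc.seg (by omega) hk, DP.single E _,
      by rw [length_seg]; omega, ?_, ?_, ?_, ?_, ?_⟩
    · intro z hz
      obtain ⟨j, h1, h2, h3⟩ := mem_seg.1 hz
      exact (hV z).2 ⟨j, by omega, h3⟩
    · intro z hz
      exact (hV z).2 ⟨0, by omega, by simp at hz; exact hz.symm⟩
    · intro z _ hz; simpa using hz
    · intro z hz hz'
      obtain ⟨j, h1, h2, rfl⟩ := mem_seg.1 hz
      rcases hz' with h | h
      · have := hc.2 j m (by omega) (by omega) (h.trans hm.symm); omega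
      · rw [h, h0]
    · intro z hz _; simpa using hz

theorem gprop_II {E : V → V → Prop} {b : ℕ} (hb : 1 ≤ b) {VG : Set V} {p q : V}
    {g : ℕ → V} {R n : ℕ} (hg : PF E g n) (hRn : R + 1 ≤ n) (hp : g n = p)
    (htoq : ∀ k, R ≤ k → k ≤ n → E (g k) q) (hqg : ∀ k, k ≤ n → g k ≠ q)
    (extra : R = 0 ∨ E (g 0) (g (R + 1)) ∨ ∃ w, R < w ∧ w ≤ n ∧ E (g w) (g 0))
    (hV : ∀ x, x ∈ VG ↔ x = q ∨ ∃ k ≤ n, g k = x) : GProp E b VG p q := by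
  classical
  subst hp
  have inj := hg.2
  have hgV : ∀ k ≤ n, g k ∈ VG := fun k hk => (hV _).2 (Or.inr ⟨k, hk, rfl⟩)
  have hqV : q ∈ VG := (hV _).2 (Or.inl rfl)
  have hsV : ∀ i j, j ≤ n → ∀ z ∈ seg g i j, z ∈ VG := by
    intro i j hj z hz
    obtain ⟨k, h1, h2, rfl⟩ := mem_seg.1 hz
    exact hgV k (by omega)
  have hsq : ∀ i j, j ≤ n → q ∉ seg g i j := by
    intro i j hj hz
    obtain ⟨k, h1, h2, h3⟩ := mem_seg.1 hz
    exact hqg k (by omega) h3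
  have hsp : ∀ i j, j < n → g n ∉ seg g i j := by
    intro i j hj hz
    obtain ⟨k, h1, h2, h3⟩ := mem_seg.1 hz
    have := inj k n (by omega) (by omega) h3
    omega
  have hnp : ∀ k, k < n → g k ≠ g n := by
    intro k hk h
    have := inj k n (by omega) (by omega) h
    omega
  have hF : ∀ x ∈ VG, Fwd E b VG (g n) q x := by
    intro x hx
    rcases (hV x).1 hx with rfl | ⟨k, hk, rfl⟩
    · exact fwd_self (Or.inr rfl) hx
    · by_cases hkn : k = n
      · subst hkn; exact fwd_self (Or.inl rfl) hx
      · have hmn : max k R < n := by omega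
        refine Or.inl ⟨q, seg g k (max k R) ++ [q], Or.inr rfl,
          (hg.seg (by omega) hmn.le).snoc (htoq _ (by omega) hmn.le) (hsq _ _ hmn.le), ?_, ?_⟩
        · intro z hz
          rw [List.mem_append, List.mem_singleton] at hz
          rcases hz with hz | rfl
          · exact hsV _ _ hmn.le z hz
          · exact hqV
        · intro z hz
          rw [List.mem_append, List.mem_singleton] at hz
          rcases hz with hz | rfl
          · rintro (rfl | h)
            · exact absurd hz (hsp _ _ hmn)
            · exact h
          · intro _; rfl
  refine gprop_of_exc (insert (g n) (insert q ((Finset.range (b - 1)).image g ∪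
      (Finset.Ico R (R + (b - 1))).image g))) ?_
    (fun x hx => Or.inl (hF x hx)) ?_
  · have h1 := Finset.card_insert_le (g n) (insert q ((Finset.range (b - 1)).image g ∪
      (Finset.Ico R (R + (b - 1))).image g))
    have h1' := Finset.card_insert_le q ((Finset.range (b - 1)).image g ∪
      (Finset.Ico R (R + (b - 1))).image g)
    have h3 := Finset.card_union_le ((Finset.range (b - 1)).image g)
      ((Finset.Ico R (R + (b - 1))).image g)
    have h2 := Finset.card_image_le (s := Finset.range (b - 1)) (f := g)
    have h2' := Finset.card_image_le (s := Finset.Ico R (R + (b - 1))) (f := g)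
    rw [Finset.card_range] at h2
    rw [Nat.card_Ico] at h2'
    omega
  · intro x hx hx'
    simp only [Finset.mem_insert, Finset.mem_union, Finset.mem_image, Finset.mem_range,
      Finset.mem_Ico, not_or, not_exists, not_and] at hx'
    obtain ⟨x1, x2, x3, x4⟩ := hx'
    rcases (hV x).1 hx with rfl | ⟨k, hk, rfl⟩
    · exact absurd rfl x2
    have hkb : b - 1 ≤ k := by
      by_contra h; exact x3 k (by omega) rfl
    have hkn : k < n := by
      rcases Nat.lt_or_ge k n with h | h
      · exact h
      · exact absurd (by rw [le_antisymm hk h]) x1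
    by_cases hkR : R ≤ k
    · have hkb' : R + (b - 1) ≤ k := by
        by_contra h; exact x4 k (by omega) rfl
      have hRq := hqg R (by omega)
      refine ⟨g R, q, seg g R k, [g R, q], Or.inr rfl, hg.seg hkR hk,
        (DP.single E q).cons (htoq R le_rfl (by omega)) (by simpa using hRq),
        by rw [length_seg]; omega, hsV _ _ hk, ?_, ?_, ?_, ?_⟩
      all_goals intro z hz
      · simp only [List.mem_cons, List.not_mem_nil, or_false] at hz
        rcases hz with rfl | rfl
        · exact hgV R (by omega)
        · exact hqV
      · simp only [List.mem_cons, List.not_mem_nil, or_false]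
        rintro (h | rfl)
        · exact h
        · exact absurd hz (hsq _ _ hk)
      · rintro (rfl | h)
        · exact absurd hz (hsp _ _ hkn)
        · exact h
      · simp only [List.mem_cons, List.not_mem_nil, or_false] at hz
        rcases hz with rfl | rfl
        · rintro (h | h)
          · exact absurd h (hnp R (by omega))
          · exact h
        · intro _; rfl
    · rcases extra with hR0 | hE | ⟨w, hRw, hwn, hE⟩
      · omega
      · have hA := hg.seg (Nat.zero_le k) hk
        have hAl : b ≤ (seg g 0 k).length := by rw [length_seg]; omega
        have hAp : ∀ t z, z ∈ seg g 0 k → z = g n ∨ z = q → z = t := by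
          rintro t z hz (rfl | rfl)
          · exact absurd hz (hsp _ _ hkn)
          · exact absurd hz (hsq _ _ hk)
        have hR1 : g (R + 1) ∉ seg g 0 k := by
          intro hz
          obtain ⟨j, h1, h2, h3⟩ := mem_seg.1 hz
          have := inj j (R + 1) (by omega) (by omega) h3
          omega
        have h0R : g 0 ≠ g (R + 1) := fun h => by
          have := inj 0 (R + 1) (by omega) (by omega) h
          omega
        by_cases hRn' : R + 1 = n
        · rw [hRn'] at hR1 hE h0R
          refine ⟨g 0, g n, seg g 0 k, [g 0, g n], Or.inl rfl, hA,
            (DP.single E _).cons hE (by simpa using h0R), hAl, hsV _ _ hk, ?_, ?_,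
            hAp _, ?_⟩
          all_goals intro z hz
          · simp only [List.mem_cons, List.not_mem_nil, or_false] at hz
            rcases hz with rfl | rfl
            · exact hgV 0 (by omega)
            · exact hgV n le_rfl
          · simp only [List.mem_cons, List.not_mem_nil, or_false]
            rintro (h | rfl)
            · exact h
            · exact absurd hz hR1
          · simp only [List.mem_cons, List.not_mem_nil, or_false] at hz
            rcases hz with rfl | rfl
            · rintro (h | h)
              · exact h
              · exact absurd h (hqg 0 (by omega))
            · intro _; rfl
        · have h1q := hqg (R + 1) (by omega)
          have h0q := hqg 0 (by omega)
          refine ⟨g 0, q, seg g 0 k, [g 0, g (R + 1), q], Or.inr rfl, hA,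
            ((DP.single E _).cons (htoq (R + 1) (by omega) (by omega)) (by simpa using h1q)).cons hE
              (by simp [h0R, h0q]), hAl, hsV _ _ hk, ?_, ?_,
            hAp _, ?_⟩
          all_goals intro z hz
          · simp only [List.mem_cons, List.not_mem_nil, or_false] at hz
            rcases hz with rfl | rfl | rfl
            · exact hgV 0 (by omega)
            · exact hgV (R + 1) (by omega)
            · exact hqV
          · simp only [List.mem_cons, List.not_mem_nil, or_false]
            rintro (h | rfl | rfl)
            · exact h
            · exact absurd hz hR1
            · exact absurd hz (hsq _ _ hk)
          · simp only [List.mem_cons, List.not_mem_nil, or_false] at hz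
            rcases hz with rfl | rfl | rfl
            · rintro (h | h)
              · exact absurd h (hnp 0 (by omega))
              · exact h
            · rintro (h | h)
              · exact absurd h (hnp (R + 1) (by omega))
              · exact h
            · intro _; rfl
      · have hwk : g w ∉ seg g 0 k := by
          intro hz
          obtain ⟨j, h1, h2, h3⟩ := mem_seg.1 hz
          have := inj j w (by omega) (by omega) h3
          omega
        have hA := (hg.seg (Nat.zero_le k) hk).cons hE hwk
        have hAl : b ≤ (g w :: seg g 0 k).length := by rw [List.length_cons, length_seg]; omega
        have hAV : ∀ z ∈ g w :: seg g 0 k, z ∈ VG := by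
          intro z hz
          rcases List.mem_cons.1 hz with rfl | h
          · exact hgV w hwn
          · exact hsV _ _ hk z h
        by_cases hwn' : w = n
        · subst hwn'
          refine ⟨g w, g w, g w :: seg g 0 k, [g w], Or.inl rfl, hA, DP.single E _, hAl, hAV,
            ?_, ?_, ?_, ?_⟩
          · intro z hz; rw [List.mem_singleton.1 hz]; exact hgV w hwn
          · intro z _ hz; exact List.mem_singleton.1 hz
          · intro z hz hz'
            rcases List.mem_cons.1 hz with h | h
            · exact h
            · rcases hz' with h' | rfl
              · exact h'
              · exact absurd h (hsq _ _ hk)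
          · intro z hz _; exact List.mem_singleton.1 hz
        · have hwq := hqg w hwn
          refine ⟨g w, q, g w :: seg g 0 k, [g w, q], Or.inr rfl, hA,
            (DP.single E q).cons (htoq w hRw.le hwn) (by simpa using hwq), hAl, hAV,
            ?_, ?_, ?_, ?_⟩
          all_goals intro z hz
          · simp only [List.mem_cons, List.not_mem_nil, or_false] at hz
            rcases hz with rfl | rfl
            · exact hgV w hwn
            · exact hqV
          · simp only [List.mem_cons, List.not_mem_nil, or_false]
            rintro (h | rfl)
            · exact h
            · rcases List.mem_cons.1 hz with h | h
              · exact h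
              · exact absurd h (hsq _ _ hk)
          · rintro (rfl | h)
            · rcases List.mem_cons.1 hz with h | h
              · exact absurd h.symm (hnp w (by omega))
              · exact absurd h (hsp _ _ hkn)
            · exact h
          · simp only [List.mem_cons, List.not_mem_nil, or_false] at hz
            rcases hz with rfl | rfl
            · rintro (h | h)
              · exact absurd h (hnp w (by omega))
              · exact h
            · intro _; rfl

theorem III_side {E : V → V → Prop} {b : ℕ} (hb : 1 ≤ b) {VG : Set V} {p q : V}
    {f f' : ℕ → V} {m m' : ℕ} (hf : PF E f m) (hf' : PF E f' m') (h0 : f 0 = p) (h0' : f' 0 = q)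
    (hr : f m = f' m') (hm : 2 * b - 1 ≤ m) (hm' : 2 * b - 1 ≤ m')
    (hint : ∀ i j, i ≤ m → j ≤ m' → f i = f' j → i = m)
    (hV : ∀ k ≤ m, f k ∈ VG) (hV' : ∀ k ≤ m', f' k ∈ VG) (k : ℕ) (hk : k ≤ m) :
    (b - 1 ≤ k → Bwd E b VG p q (f k)) ∧ (k < b - 1 → Fwd E b VG p q (f k)) := by
  subst h0 h0'
  have hq : ∀ j ≤ m, f j ≠ f' 0 := by
    intro j hj h
    have h1 := hint j 0 hj (by omega) h
    subst h1
    have := hf'.2 0 m' (by omega) le_rfl (h.symm.trans hr)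
    omega
  have hp : ∀ j ≤ m', f' j ≠ f 0 := by
    intro j hj h
    have h1 := hint 0 j (by omega) hj h.symm
    omega
  constructor
  · intro hkb
    refine ⟨f 0, f 0, seg f 0 k, [f 0], Or.inl rfl, hf.seg (by omega) hk, DP.single E _,
      by rw [length_seg]; omega, ?_, ?_, ?_, ?_, ?_⟩
    · intro z hz
      obtain ⟨j, h1, h2, rfl⟩ := mem_seg.1 hz
      exact hV j (by omega)
    · intro z hz; rw [List.mem_singleton.1 hz]; exact hV 0 (by omega)
    · intro z _ hz; exact List.mem_singleton.1 hz
    · intro z hz hz'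
      obtain ⟨j, h1, h2, rfl⟩ := mem_seg.1 hz
      rcases hz' with h | h
      · exact h
      · exact absurd h (hq j (by omega))
    · intro z hz _; exact List.mem_singleton.1 hz
  · intro hkb
    by_cases hk0 : k = 0
    · subst hk0; exact fwd_self (Or.inl rfl) (hV 0 (by omega))
    refine Or.inr ⟨f' 0, f m, seg f k m, seg f' 0 m', Or.inr rfl, hf.seg hk le_rfl, ?_,
      by rw [length_seg]; omega, by rw [length_seg]; omega, ?_, ?_, ?_, ?_, ?_⟩
    · rw [hr]; exact hf'.seg (by omega) le_rfl
    · intro z hz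
      obtain ⟨j, h1, h2, rfl⟩ := mem_seg.1 hz
      exact hV j (by omega)
    · intro z hz
      obtain ⟨j, h1, h2, rfl⟩ := mem_seg.1 hz
      exact hV' j (by omega)
    · intro z hz hz'
      obtain ⟨j, h1, h2, rfl⟩ := mem_seg.1 hz
      obtain ⟨j', h1', h2', h3'⟩ := mem_seg.1 hz'
      rw [hint j j' h2 h2' h3'.symm]
    · intro z hz hz'
      obtain ⟨j, h1, h2, rfl⟩ := mem_seg.1 hz
      rcases hz' with h | h
      · have := hf.2 j 0 (by omega) (by omega) h; omega
      · exact h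
    · intro z hz hz'
      obtain ⟨j, h1, h2, rfl⟩ := mem_seg.1 hz
      rcases hz' with h | h
      · exact absurd h (hp j (by omega))
      · exact h

theorem Bwd.swap {E : V → V → Prop} {b : ℕ} {VG : Set V} {p q x : V}
    (h : Bwd E b VG p q x) : Bwd E b VG q p x := by
  unfold Bwd at h ⊢
  simp only [or_comm (a := _ = q)]
  exact h

theorem Fwd.swap {E : V → V → Prop} {b : ℕ} {VG : Set V} {p q x : V}
    (h : Fwd E b VG p q x) : Fwd E b VG q p x := by
  unfold Fwd at h ⊢
  simp only [or_comm (a := _ = q)]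
  exact h

theorem gprop_III {E : V → V → Prop} {b : ℕ} (hb : 1 ≤ b) {VG : Set V} {p q : V}
    {f f' : ℕ → V} {m m' : ℕ} (hf : PF E f m) (hf' : PF E f' m') (h0 : f 0 = p) (h0' : f' 0 = q)
    (hr : f m = f' m') (hm : 2 * b - 1 ≤ m) (hm' : 2 * b - 1 ≤ m')
    (hint : ∀ i j, i ≤ m → j ≤ m' → f i = f' j → i = m)
    (hV : ∀ x, x ∈ VG ↔ (∃ k ≤ m, f k = x) ∨ (∃ k ≤ m', f' k = x)) : GProp E b VG p q := by
  classical
  have hint' : ∀ i j, i ≤ m' → j ≤ m → f' i = f j → i = m' := by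
    intro i j hi hj h
    have := hint j i hj hi h.symm
    subst this
    exact hf'.2 i m' hi le_rfl (h.trans hr)
  have hV1 : ∀ k ≤ m, f k ∈ VG := fun k hk => (hV _).2 (Or.inl ⟨k, hk, rfl⟩)
  have hV2 : ∀ k ≤ m', f' k ∈ VG := fun k hk => (hV _).2 (Or.inr ⟨k, hk, rfl⟩)
  have S1 := III_side hb hf hf' h0 h0' hr hm hm' hint hV1 hV2
  have S2 := III_side hb hf' hf h0' h0 hr.symm hm' hm hint' hV2 hV1
  refine gprop_of_exc ((Finset.range (b - 1)).image f ∪ (Finset.range (b - 1)).image f') ?_ ?_ ?_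
  · have h3 := Finset.card_union_le ((Finset.range (b - 1)).image f)
      ((Finset.range (b - 1)).image f')
    have h2 := Finset.card_image_le (s := Finset.range (b - 1)) (f := f)
    have h2' := Finset.card_image_le (s := Finset.range (b - 1)) (f := f')
    rw [Finset.card_range] at h2 h2'
    omega
  · intro x hx
    rcases (hV x).1 hx with ⟨k, hk, rfl⟩ | ⟨k, hk, rfl⟩
    · rcases Nat.lt_or_ge k (b - 1) with h | h
      · exact Or.inl ((S1 k hk).2 h)
      · exact Or.inr ((S1 k hk).1 h)
    · rcases Nat.lt_or_ge k (b - 1) with h | h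
      · exact Or.inl ((S2 k hk).2 h).swap
      · exact Or.inr ((S2 k hk).1 h).swap
  · intro x hx hx'
    simp only [Finset.mem_union, Finset.mem_image, Finset.mem_range, not_or, not_exists,
      not_and] at hx'
    rcases (hV x).1 hx with ⟨k, hk, rfl⟩ | ⟨k, hk, rfl⟩
    · exact (S1 k hk).1 (by by_contra h; exact hx'.1 k (by omega) rfl)
    · exact ((S2 k hk).1 (by by_contra h; exact hx'.2 k (by omega) rfl)).swap

theorem ext_fun {D E : V → V → Prop} {b : ℕ} (hb : 1 ≤ b) (G : ExtIIGadget D b)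
    (hE : ∀ x y, G.arcs x y → E x y) :
    ∃ (g : ℕ → V) (R n : ℕ), PF E g n ∧ b ≤ R ∧ R + (2 * b ^ 2 + b - 2) ≤ n ∧ g n = G.p ∧
    (∀ k, R ≤ k → k ≤ n → E (g k) G.q) ∧ (∀ k, k ≤ n → g k ≠ G.q) ∧
    (E (g 0) (g (R + 1)) ∨ ∃ w, R < w ∧ w ≤ n ∧ E (g w) (g 0)) ∧
    (∀ x, x ∈ G.verts ↔ x = G.q ∨ ∃ k ≤ n, g k = x) := by
  have hbb : b ≤ b ^ 2 := by nlinarith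
  have hl1 := G.len₁
  have hl2 := G.len₂
  cases hz : G.P₂.head? with
  | none => simp at hz; exact absurd hz G.path₂.1
  | some z =>
  obtain ⟨f, hf, f0, fn, fm, f1⟩ := of_list (E := E) G.path₁.2.1
    (fun x y h => hE x y (Or.inl h)) G.first₁ G.last₁
  obtain ⟨h, hh, h0, hn, hm, -⟩ := of_list (E := E) G.path₂.2.1
    (fun x y h => hE x y (Or.inr (Or.inr (Or.inl h)))) hz G.last₂
  set N := G.P₁.length - 1 with hN
  set R := G.P₂.length - 1 with hR
  have hRf : h R = f 0 := hn.trans f0.symm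
  have hg1 : ∀ k, k ≤ R → (fun k => if k ≤ R then h k else f (k - R)) k = h k := by
    intro k hk; simp [hk]
  have hg2 : ∀ k, R ≤ k → (fun k => if k ≤ R then h k else f (k - R)) k = f (k - R) := by
    intro k hk
    by_cases e : k = R
    · subst e; simp [hRf]
    · have : ¬ k ≤ R := by omega
      simp [this]
  generalize (fun k => if k ≤ R then h k else f (k - R)) = g at hg1 hg2
  have cross : ∀ i j, i ≤ R → j ≤ N → h i = f j → i = R ∧ j = 0 := by
    intro i j hi hj e
    have e2 := G.inter (f j) ((fm _).2 ⟨j, hj, rfl⟩) ((hm _).2 ⟨i, hi, e⟩)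
    exact ⟨hh.2 i R hi le_rfl (by rw [e, e2, hn]), hf.2 j 0 hj (by omega) (by rw [e2, f0])⟩
  have toq : ∀ k, R ≤ k → k ≤ R + N → E (g k) G.q := by
    intro k h1 h2
    rw [hg2 k h1]
    exact hE _ _ (Or.inr (Or.inl ⟨(fm _).2 ⟨k - R, by omega, rfl⟩, rfl⟩))
  refine ⟨g, R, R + N, ⟨?_, ?_⟩, by omega, by omega, ?_, toq, ?_, ?_, ?_⟩
  · intro k hk
    rcases Nat.lt_or_ge k R with h' | h'
    · rw [hg1 k h'.le, hg1 (k + 1) h']; exact hh.1 k h'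
    · rw [hg2 k h', hg2 (k + 1) (by omega)]
      have : k + 1 - R = k - R + 1 := by omega
      rw [this]; exact hf.1 _ (by omega)
  · intro i j hi hj e
    rcases le_total i R with h1 | h1 <;> rcases le_total j R with h2 | h2
    · rw [hg1 i h1, hg1 j h2] at e; exact hh.2 i j h1 h2 e
    · rw [hg1 i h1, hg2 j h2] at e
      have := cross i (j - R) h1 (by omega) e
      omega
    · rw [hg2 i h1, hg1 j h2] at e
      have := cross j (i - R) h2 (by omega) e.symm
      omega
    · rw [hg2 i h1, hg2 j h2] at e
      have := hf.2 (i - R) (j - R) (by omega) (by omega) e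
      omega
  · rw [hg2 _ (by omega)]
    have : R + N - R = N := by omega
    rw [this]; exact fn
  · intro k hk e
    rcases le_total k R with h1 | h1
    · rw [hg1 k h1] at e
      exact G.hq₂ (e ▸ (hm _).2 ⟨k, h1, rfl⟩)
    · rw [hg2 k h1] at e
      exact G.hq (e ▸ (fm _).2 ⟨k - R, by omega, rfl⟩)
  · rcases G.extra with ⟨z', y, hz', hy, hD⟩ | ⟨w, z', hw, hwr, hz', hD⟩
    · left
      have : R + 1 - R = 1 := by omega
      rw [hg1 0 (by omega), hg2 (R + 1) (by omega), this, f1 y hy, h0]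
      rw [hz] at hz'
      obtain rfl := Option.some.inj hz'
      exact hE _ _ (Or.inr (Or.inr (Or.inr ⟨hD, Or.inl ⟨hz, hy⟩⟩)))
    · right
      obtain ⟨k, hk, rfl⟩ := (fm w).1 hw
      have hk0 : k ≠ 0 := by rintro rfl; exact hwr f0
      refine ⟨R + k, by omega, by omega, ?_⟩
      have : R + k - R = k := by omega
      rw [hg1 0 (by omega), hg2 (R + k) (by omega), this, h0]
      rw [hz] at hz'
      obtain rfl := Option.some.inj hz'
      exact hE _ _ (Or.inr (Or.inr (Or.inr ⟨hD, Or.inr ⟨hw, hwr, hz⟩⟩)))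
  · intro x
    have : x ∈ G.verts ↔ x = G.q ∨ x ∈ G.P₁ ∨ x ∈ G.P₂ := Iff.rfl
    rw [this, fm, hm]
    constructor
    · rintro (h | ⟨k, hk, rfl⟩ | ⟨k, hk, rfl⟩)
      · exact Or.inl h
      · refine Or.inr ⟨R + k, by omega, ?_⟩
        rw [hg2 _ (by omega)]; congr 1; omega
      · exact Or.inr ⟨k, by omega, hg1 k hk⟩
    · rintro (h | ⟨k, hk, rfl⟩)
      · exact Or.inl h
      · rcases le_total k R with h1 | h1
        · exact Or.inr (Or.inr ⟨k, h1, (hg1 k h1).symm⟩)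
        · exact Or.inr (Or.inl ⟨k - R, by omega, (hg2 k h1).symm⟩)

theorem gprop_any {D E : V → V → Prop} {b : ℕ} (hb : 1 ≤ b) (G : GadgetAny D b)
    (hE : ∀ x y, G.arcs x y → E x y) :
    GProp E b G.verts G.pp G.qq ∧ G.pp ∈ G.verts ∧ G.qq ∈ G.verts := by
  have hbb : b ≤ b ^ 2 := by nlinarith
  cases G with
  | triv G =>
    refine ⟨gprop_triv hb (fun x => Iff.rfl), Or.inl rfl, Or.inr rfl⟩
  | I G =>
    have hg := G.glen
    have hnd := G.nodup
    have hnd' : (G.q :: (G.rest ++ [G.p])).Nodup := by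
      have : (G.q :: (G.rest ++ [G.p])).Perm (G.p :: G.q :: G.rest) :=
        List.perm_append_singleton G.p (G.q :: G.rest)
      exact this.nodup_iff.2 hnd
    obtain ⟨c, hc, c0, cm, cmem, -⟩ := of_list (E := E) hnd' (u := G.q) (v := G.p) (by
      intro x y h
      apply hE
      obtain ⟨l₁, l₂, e⟩ := h
      exact ⟨G.p :: l₁, l₂, by rw [e]; rfl⟩) (by simp)
      (by rw [← List.cons_append]; exact List.getLast?_concat ..)
    refine ⟨gprop_I hb hc c0 cm (by simp) ?_, ?_, ?_⟩
    · intro x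
      rw [← cmem]
      have : x ∈ G.verts ↔ x ∈ G.p :: G.q :: G.rest := Iff.rfl
      change x ∈ G.verts ↔ _
      rw [this]
      simp only [List.mem_cons, List.mem_append, List.not_mem_nil, or_false]
      tauto
    · change G.p ∈ G.p :: G.q :: G.rest
      simp
    · change G.q ∈ G.p :: G.q :: G.rest
      simp
  | II G =>
    have hl := G.len₁
    obtain ⟨f, hf, f0, fn, fm, f1⟩ := of_list (E := E) G.path₁.2.1
      (fun x y h => hE x y (Or.inl h)) G.first₁ G.last₁
    refine ⟨gprop_II (R := 0) hb hf (by omega) fn ?_ ?_ (Or.inl rfl) ?_, ?_, ?_⟩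
    · intro k _ hk
      exact hE _ _ (Or.inr ⟨(fm _).2 ⟨k, hk, rfl⟩, rfl⟩)
    · intro k hk e
      exact G.hq ((fm _).2 ⟨k, hk, e⟩)
    · intro x
      rw [← fm]
      exact Iff.rfl
    · exact Or.inr (List.mem_of_getLast? G.last₁)
    · exact Or.inl rfl
  | IIext G =>
    obtain ⟨g, R, n, h1, h2, h3, h4, h5, h6, h7, h8⟩ := ext_fun hb G hE
    exact ⟨gprop_II hb h1 (by omega) h4 h5 h6 (Or.inr h7) h8,
      (h8 _).2 (Or.inr ⟨n, le_rfl, h4⟩), (h8 _).2 (Or.inl rfl)⟩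
  | III G =>
    have hl1 := G.len₁
    have hl2 := G.len₂
    obtain ⟨f, hf, f0, fn, fm, -⟩ := of_list (E := E) G.path₁.2.1
      (fun x y h => hE x y (Or.inr (Or.inl h))) G.first₁ G.last₁
    obtain ⟨f', hf', f0', fn', fm', -⟩ := of_list (E := E) G.path₂.2.1
      (fun x y h => hE x y (Or.inr (Or.inr h))) G.first₂ G.last₂
    refine ⟨gprop_III hb hf hf' f0 f0' (fn.trans fn'.symm) (by omega) (by omega) ?_ ?_, ?_, ?_⟩
    · intro i j hi hj e
      have e2 := G.inter (f i) ((fm _).2 ⟨i, hi, rfl⟩) ((fm' _).2 ⟨j, hj, e.symm⟩)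
      exact hf.2 i _ hi le_rfl (e2.trans fn.symm)
    · intro x
      rw [← fm, ← fm']
      exact Iff.rfl
    · exact Or.inl (List.mem_of_head? G.first₁)
    · exact Or.inr (List.mem_of_head? G.first₂)

end Helpers

/-- Let `G` be any gadget (trivial, type I, basic or extended type II,
or type III) and `G*` an extended type-II gadget meeting `G` but with `p(G*), q(G*)`
outside `V(G)`. Then for some `a ∈ {1,2,3}`, `G ∪ G*` contains an `(a,b)`-alternating
path `R` with `t_a(R) ∈ {p(G), q(G)}`, `s_1(R) ∈ {p(G*), q(G*)}`,
`|V(R) ∩ {p(G), q(G)}| = 1` and `|V(R) ∩ {p(G*), q(G*)}| = 1`. -/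
theorem stmt_11 {V : Type*} [Fintype V] (D : V → V → Prop) (hloop : ∀ v, ¬ D v v)
    (b : ℕ) (hb : 1 ≤ b) (G : GadgetAny D b) (Gs : ExtIIGadget D b)
    (hmeet : ∃ x, x ∈ G.verts ∧ x ∈ Gs.verts)
    (hps : Gs.p ∉ G.verts) (hqs : Gs.q ∉ G.verts) :
    ∃ (a : ℕ) (ha : 0 < a), a ≤ 3 ∧
      ∃ R : AltPath (fun x y => G.arcs x y ∨ Gs.arcs x y) a b,
        (R.t ⟨a - 1, by omega⟩ = G.pp ∨ R.t ⟨a - 1, by omega⟩ = G.qq) ∧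
        (R.s ⟨0, ha⟩ = Gs.p ∨ R.s ⟨0, ha⟩ = Gs.q) ∧
        (∀ z ∈ R.verts, z = G.pp ∨ z = G.qq → z = R.t ⟨a - 1, by omega⟩) ∧
        (∀ z ∈ R.verts, z = Gs.p ∨ z = Gs.q → z = R.s ⟨0, ha⟩) := by
  have hG := gprop_any (E := fun x y => G.arcs x y ∨ Gs.arcs x y) hb G (fun _ _ h => Or.inl h)
  obtain ⟨⟨hFB, hcard⟩, hp, hq⟩ := hG
  obtain ⟨g, R, n, h1, h2, h3, h4, h5, h6, h7, h8⟩ :=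
    ext_fun (E := fun x y => G.arcs x y ∨ Gs.arcs x y) hb Gs (fun _ _ h => Or.inr h)
  obtain ⟨x, hx, hx'⟩ := hmeet
  have hm : ∃ k, k ≤ n ∧ g k ∈ G.verts := by
    rcases (h8 x).1 hx' with rfl | ⟨k, hk, rfl⟩
    · exact absurd hx hqs
    · exact ⟨k, hk, hx⟩
  have key := main_abs hb h1 h2 h3 h5 h6 h7 hp hq (h4 ▸ hps) hqs hm hFB hcard
  rw [h4] at key
  exact key

end Paper
end

section
/- Let a ≥ 2 and b ≥ 1 be integers, let 𝒞 be a chain contained in a digraph D with spine P = z_0,…,z_ℓ and arc partition A_1 ∪ A_2, and suppose |A_2| ≥ (a+3)(b+1) − 2. Assume that at least one of the following holds: (1) there exists x ∈ V(G_{(z_0,z_1)}) with (z_ℓ,x) ∈ A(D); or (2) there exists z* ∈ V(D)∖V(𝒞) with (z_ℓ,z*) ∈ A(D) and an extended type-II gadget G* in D with p(G*) = z_ℓ, q(G*) = z*, V(G_{(z_0,z_1)}) ∩ V(G*) ≠ ∅ and V(𝒞) ∩ V(G*) ⊆ V(G_{(z_0,z_1)}) ∪ {z_ℓ}. Then D contains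 a subdivision of C_{a,b}. -/
namespace Paper

/-- Arc traversed in the direction given by the parity of `k`. -/
def Arc {V : Type*} (D : V → V → Prop) (k : ℕ) (v w : V) : Prop :=
  if k % 2 = 0 then D v w else D w v

theorem core2 {V : Type*} (D : V → V → Prop) (a b N : ℕ) (ha : 2 ≤ a) (hb : 1 ≤ b)
    (c : ℕ → V) (pos : ℕ → ℕ) (h0 : pos 0 = 0) (hN : pos (2 * a * b) = N)
    (hmono : ∀ i < 2 * a * b, pos i < pos (i + 1))
    (hinj : ∀ i < N, ∀ j < N, c i = c j → i = j) (hc : c N = c 0)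
    (harc : ∀ i < 2 * a * b, ∀ n, pos i ≤ n → n < pos (i + 1) →
      Arc D (i / b) (c n) (c (n + 1))) :
    ContainsSubdivisionOf D (Cab a b) := by
  classical
  have hM : 4 ≤ 2 * a * b := by nlinarith
  unfold Cab
  generalize 2 * a * b = M at *
  have : NeZero M := ⟨by omega⟩
  have hle : ∀ i j, i ≤ j → j ≤ M → pos i ≤ pos j := by
    intro i j hij
    induction j, hij using Nat.le_induction with
    | base => intro; exact le_rfl
    | succ j hij ih => intro hj; exact (ih (by omega)).trans (hmono j (by omega)).le
  have hlt : ∀ i j, i < j → j ≤ M → pos i < pos j := by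
    intro i j hij hj
    exact (hmono i (by omega)).trans_le (hle (i+1) j hij hj)
  have key : ∀ n n', n ≤ N → n' ≤ N → c n = c n' → n = n' ∨ (n = 0 ∧ n' = N) ∨ (n = N ∧ n' = 0) := by
    intro n n' h h' e
    have hNp : 0 < N := by rw [← hN, ← h0]; exact hlt 0 M (by omega) le_rfl
    rcases h.lt_or_eq with h1 | h1 <;> rcases h'.lt_or_eq with h2 | h2
    · exact Or.inl (hinj n h1 n' h2 e)
    · subst h2; rw [hc] at e; have := hinj n h1 0 hNp e; omega
    · subst h1; rw [hc] at e; have := hinj 0 hNp n' h2 e; omega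
    · omega
  let Seg : ℕ → List V := fun i => (List.range' (pos i) (pos (i+1) - pos i + 1)).map c
  let φ : ZMod M → V := fun x => c (pos x.val)
  have hφ : ∀ i, i ≤ M → φ (i : ZMod M) = c (pos i) := by
    intro i hi
    rcases hi.lt_or_eq with h | h
    · simp only [φ]; rw [ZMod.val_natCast, Nat.mod_eq_of_lt h]
    · subst h; simp only [φ]; simp [h0, hN, hc]
  have hφinj : Function.Injective φ := by
    intro x y h
    have h1 := hlt _ M (ZMod.val_lt x) le_rfl
    have h2 := hlt _ M (ZMod.val_lt y) le_rfl
    rw [hN] at h1 h2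
    have h3 := hinj _ h1 _ h2 h
    apply ZMod.val_injective M
    rcases lt_trichotomy x.val y.val with h4 | h4 | h4
    · have := hlt _ _ h4 (ZMod.val_lt y).le; omega
    · exact h4
    · have := hlt _ _ h4 (ZMod.val_lt x).le; omega
  have memSeg : ∀ i z, z ∈ Seg i ↔ ∃ n, pos i ≤ n ∧ n < pos (i+1) + 1 + (pos i - pos (i+1)) ∧ c n = z := by
    intro i z
    simp only [Seg, List.mem_map, List.mem_range'_1]
    constructor
    · rintro ⟨n, ⟨h1, h2⟩, h3⟩; exact ⟨n, h1, by omega, h3⟩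
    · rintro ⟨n, h1, h2, h3⟩; exact ⟨n, ⟨h1, by omega⟩, h3⟩
  have memInt : ∀ i, i < M → ∀ z, z ∈ (Seg i).tail.dropLast → ∃ n, pos i < n ∧ n < pos (i+1) ∧ c n = z := by
    intro i hi z hz
    have := hmono i hi
    obtain ⟨d, hd⟩ : ∃ d, pos (i+1) = pos i + d + 1 := ⟨pos (i+1) - pos i - 1, by omega⟩
    have e : pos (i+1) - pos i + 1 = d + 1 + 1 := by omega
    simp only [Seg, e] at hz
    rw [List.range'_succ, List.map_cons, List.tail_cons, List.range'_concat, List.map_append] at hz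
    simp only [List.map_cons, List.map_nil, List.dropLast_concat, List.mem_map, List.mem_range'_1] at hz
    obtain ⟨n, ⟨h1, h2⟩, h3⟩ := hz
    exact ⟨n, by omega, by omega, h3⟩
  have nodupSeg : ∀ i < M, (Seg i).Nodup := by
    intro i hi
    refine List.Nodup.map_on ?_ List.nodup_range'
    intro x hx y hy h
    rw [List.mem_range'_1] at hx hy
    have := hmono i hi
    have h5 := hle (i+1) M (by omega) le_rfl
    rcases key x y (by omega) (by omega) h with h | h | h
    · exact h
    · exfalso
      have h6 : i = 0 := by
        by_contra h7; have := hlt 0 i (by omega) (by omega); omega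
      have := hlt (i+1) M (by omega) le_rfl; omega
    · exfalso
      have h6 : i = 0 := by
        by_contra h7; have := hlt 0 i (by omega) (by omega); omega
      have := hlt (i+1) M (by omega) le_rfl; omega
  have headSeg : ∀ i < M, (Seg i).head? = some (c (pos i)) := by
    intro i hi; simp only [Seg]; rw [List.range'_succ]; simp
  have lastSeg : ∀ i < M, (Seg i).getLast? = some (c (pos (i+1))) := by
    intro i hi; simp only [Seg]; rw [List.range'_concat]; simp
    have := hmono i hi; congr 1; omega
  have lenSeg : ∀ i < M, 2 ≤ (Seg i).length := by
    intro i hi; simp only [Seg]; simp; have := hmono i hi; omega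
  have chainSeg : ∀ i < M, (Seg i).IsChain (fun x y => Arc D (i/b) x y) := by
    intro i hi
    rw [List.isChain_iff_getElem]
    intro n hn
    simp only [Seg, List.length_map, List.length_range'] at hn
    simp only [Seg, List.getElem_map, List.getElem_range']
    have := harc i hi (pos i + n) (by omega) (by omega)
    simpa [add_assoc] using this
  -- interior of one segment avoids another
  have disj : ∀ i < M, ∀ j < M, i ≠ j → ∀ z ∈ (Seg i).tail.dropLast, z ∉ Seg j := by
    intro i hi j hj hij z hz hz'
    obtain ⟨n, h1, h2, h3⟩ := memInt i hi z hz
    obtain ⟨n', h4, h5, h6⟩ := (memSeg j z).1 hz'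
    have hi5 := hle (i+1) M (by omega) le_rfl
    have hj5 := hle (j+1) M (by omega) le_rfl
    have := hmono i hi
    have := hmono j hj
    rcases key n n' (by omega) (by omega) (h3.trans h6.symm) with h | h | h
    · rcases lt_or_gt_of_ne hij with h7 | h7
      · have := hle (i+1) j h7 (by omega); omega
      · have := hle (j+1) i h7 (by omega); omega
    · omega
    · omega
  have intφ : ∀ i < M, ∀ z ∈ (Seg i).tail.dropLast, ∀ w, φ w ≠ z := by
    intro i hi z hz w hw
    obtain ⟨n, h1, h2, h3⟩ := memInt i hi z hz
    have hi5 := hle (i+1) M (by omega) le_rfl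
    have hw2 := hlt _ M (ZMod.val_lt w) le_rfl
    rcases key n (pos w.val) (by omega) (by omega) (h3.trans hw.symm) with h | h | h
    · rcases lt_or_ge i w.val with h7 | h7
      · have := hle (i+1) _ h7 (ZMod.val_lt w).le; omega
      · have := hle _ i h7 (by omega); omega
    · omega
    · omega
  let Q : ℕ → List V := fun i => if (i / b) % 2 = 0 then Seg i else (Seg i).reverse
  have memQ : ∀ i z, z ∈ Q i ↔ z ∈ Seg i := by
    intro i z; simp only [Q]; split_ifs <;> simp
  have memQint : ∀ i z, z ∈ (Q i).tail.dropLast ↔ z ∈ (Seg i).tail.dropLast := by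
    intro i z; simp only [Q]; split_ifs
    · rfl
    · rw [List.tail_reverse, List.dropLast_reverse, List.mem_reverse, List.tail_dropLast]
  let Cond : ZMod M → ZMod M → ℕ → Prop := fun x y i => i < M ∧
    (((i / b) % 2 = 0 ∧ x = (i : ZMod M) ∧ y = ((i + 1 : ℕ) : ZMod M)) ∨
     ((i / b) % 2 = 1 ∧ x = ((i + 1 : ℕ) : ZMod M) ∧ y = (i : ZMod M)))
  let P : ZMod M → ZMod M → List V := fun x y =>
    if h : ∃ i, Cond x y i then Q h.choose else []
  have hP : ∀ x y, (∃ i, Cond x y i) → ∃ i, Cond x y i ∧ P x y = Q i := by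
    intro x y h
    exact ⟨h.choose, h.choose_spec, by simp only [P]; rw [dif_pos h]⟩
  refine ⟨φ, P, hφinj, ?_, ?_⟩
  · intro x y hxy
    obtain ⟨i, ⟨hi, hcond⟩, hPi⟩ := hP x y hxy
    rw [hPi]
    have h1 : ∀ z ∈ (Q i).tail.dropLast, ∀ w, φ w ≠ z := by
      intro z hz; exact intφ i hi z ((memQint i z).1 hz)
    have hne : Seg i ≠ [] := by
      have := lenSeg i hi; intro h; simp [h] at this
    have hch := chainSeg i hi
    rcases hcond with ⟨hp, hx, hy⟩ | ⟨hp, hx, hy⟩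
    · have hQ : Q i = Seg i := by simp only [Q]; rw [if_pos hp]
      rw [hQ] at h1 ⊢
      refine ⟨⟨hne, nodupSeg i hi, ?_⟩, ?_, ?_, lenSeg i hi, h1⟩
      · change List.IsChain _ _
        simpa [Arc, hp] using hch
      · rw [hx, hφ i hi.le]; exact headSeg i hi
      · rw [hy, hφ (i+1) hi]; exact lastSeg i hi
    · have hQ : Q i = (Seg i).reverse := by simp only [Q]; rw [if_neg (by omega)]
      rw [hQ] at h1 ⊢
      refine ⟨⟨by simpa using hne, by simpa using nodupSeg i hi, ?_⟩, ?_, ?_, by simpa using lenSeg i hi, h1⟩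
      · change List.IsChain _ _
        rw [List.isChain_reverse]
        simpa [Arc, hp] using hch
      · rw [hx, hφ (i+1) hi, List.head?_reverse]; exact lastSeg i hi
      · rw [hy, hφ i hi.le, List.getLast?_reverse]; exact headSeg i hi
  · intro x y x' y' h h' hne z hz hz'
    obtain ⟨i, ⟨hi, hcond⟩, hPi⟩ := hP x y h
    obtain ⟨j, ⟨hj, hcond'⟩, hPj⟩ := hP x' y' h'
    rw [hPi] at hz
    rw [hPj] at hz'
    refine disj i hi j hj ?_ z ((memQint i z).1 hz) ((memQ j z).1 hz')
    rintro rfl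
    apply hne
    rcases hcond with ⟨hp, hx, hy⟩ | ⟨hp, hx, hy⟩ <;> rcases hcond' with ⟨hp', hx', hy'⟩ | ⟨hp', hx', hy'⟩
    · rw [hx, hy, hx', hy']
    · omega
    · omega
    · rw [hx, hy, hx', hy']

theorem core {V : Type*} (D : V → V → Prop) (a b N : ℕ) (ha : 2 ≤ a) (hb : 1 ≤ b)
    (c : ℕ → V) (st : ℕ → ℕ) (h0 : st 0 = 0) (hN : st (2 * a) = N)
    (hst : ∀ j < 2 * a, st j + b ≤ st (j + 1))
    (hinj : ∀ i < N, ∀ j < N, c i = c j → i = j) (hc : c N = c 0)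
    (harc : ∀ j < 2 * a, ∀ n, st j ≤ n → n < st (j + 1) →
      Arc D j (c n) (c (n + 1))) :
    ContainsSubdivisionOf D (Cab a b) := by
  have hstep : ∀ i < 2 * a * b, st (i / b) + i % b < st ((i+1) / b) + (i+1) % b ∧
      st ((i+1) / b) + (i+1) % b ≤ st (i / b + 1) := by
    intro i hi
    have hj : i / b < 2 * a := by rw [Nat.div_lt_iff_lt_mul (by omega)]; exact hi
    have h1 := hst _ hj
    have h2 : i % b < b := Nat.mod_lt _ (by omega)
    have h3 := Nat.div_add_mod i b
    by_cases h : i % b + 1 = b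
    · have e : i + 1 = b * (i / b + 1) := by rw [Nat.mul_add]; omega
      have e1 : (i + 1) / b = i / b + 1 := by rw [e]; exact Nat.mul_div_cancel_left _ (by omega)
      have e2 : (i + 1) % b = 0 := by rw [e]; exact Nat.mul_mod_right _ _
      rw [e1, e2]; omega
    · have e : i + 1 = (i % b + 1) + b * (i / b) := by omega
      have e1 : (i + 1) / b = i / b := by
        rw [e, Nat.add_mul_div_left _ _ (by omega), Nat.div_eq_of_lt (by omega)]; simp
      have e2 : (i + 1) % b = i % b + 1 := by
        rw [e, Nat.add_mul_mod_self_left, Nat.mod_eq_of_lt (by omega)]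
      rw [e1, e2]; omega
  refine core2 D a b N ha hb c (fun i => st (i / b) + i % b) ?_ ?_ ?_ hinj hc ?_
  · simp [h0]
  · rw [Nat.mul_div_cancel _ (by omega)]; simp [hN]
  · intro i hi; exact (hstep i hi).1
  · intro i hi n h1 h2
    have hj : i / b < 2 * a := by rw [Nat.div_lt_iff_lt_mul (by omega)]; exact hi
    have := hstep i hi
    exact harc _ hj n (by omega) (by omega)

end Paper
namespace Paper

/-- Runs of the alternation automaton: `Run D b k r u l k' r' v` says that `l ++ [v]` is an
oriented walk from `u` to `v`; `k` counts direction switches, `r` is a lower bound on the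
length of the current block; switching requires `b ≤ r`. -/
inductive Run {V : Type*} (D : V → V → Prop) (b : ℕ) (k r : ℕ) (u : V) :
    List V → ℕ → ℕ → V → Prop
  | nil : Run D b k r u [] k r u
  | step {l k' r' v w} : Run D b k r u l k' r' v → Arc D k' v w →
      Run D b k r u (l ++ [v]) k' (r' + 1) w
  | sw {l k' r' v} : Run D b k r u l k' r' v → b ≤ r' → Run D b k r u l (k' + 1) 0 v
  | weak {l k' r' r'' v} : Run D b k r u l k' r' v → r'' ≤ r' → Run D b k r u l k' r'' v

variable {V : Type*} {D : V → V → Prop} {b : ℕ}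

theorem Arc_add_two {k : ℕ} {v w : V} : Arc D (k + 2) v w ↔ Arc D k v w := by
  simp [Arc]

theorem Run.trans {k r u l k' r' v l' k'' r'' w} (h : Run D b k r u l k' r' v)
    (h' : Run D b k' r' v l' k'' r'' w) : Run D b k r u (l ++ l') k'' r'' w := by
  induction h' with
  | nil => simpa using h
  | step _ ha ih => rw [← List.append_assoc]; exact ih.step ha
  | sw _ hb ih => exact ih.sw hb
  | weak _ hr ih => exact ih.weak hr

theorem Run.mono {k r u l k' r' v R} (h : Run D b k r u l k' r' v) (hR : r ≤ R) :
    Run D b k R u l k' r' v := by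
  induction h with
  | nil => exact Run.nil.weak hR
  | step _ ha ih => exact ih.step ha
  | sw _ hb ih => exact ih.sw hb
  | weak _ hr ih => exact ih.weak hr

theorem Run.shift {k r u l k' r' v} (h : Run D b k r u l k' r' v) :
    Run D b (k + 2) r u l (k' + 2) r' v := by
  induction h with
  | nil => exact Run.nil
  | step _ ha ih => exact ih.step (Arc_add_two.2 ha)
  | sw _ hb ih => exact ih.sw hb
  | weak _ hr ih => exact ih.weak hr

theorem Run.shifts {k r u l k' r' v} (h : Run D b k r u l k' r' v) (n : ℕ) :
    Run D b (k + 2 * n) r u l (k' + 2 * n) r' v := by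
  induction n with
  | zero => exact h
  | succ n ih => exact ih.shift

theorem Run.le {k r u l k' r' v} (h : Run D b k r u l k' r' v) : k ≤ k' := by
  induction h with
  | nil => exact le_rfl
  | step _ ha ih => exact ih
  | sw _ hb ih => omega
  | weak _ hr ih => exact ih

/-- split at the first switch -/
theorem Run.split {k r u l k' r' v} (h : Run D b k r u l k' r' v) (hk : k < k') :
    ∃ l₁ l₂ R w, l = l₁ ++ l₂ ∧ b ≤ R ∧ Run D b k r u l₁ k R w ∧
      Run D b (k + 1) 0 w l₂ k' r' v := by
  induction h with
  | nil => omega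
  | step _ ha ih =>
    obtain ⟨l₁, l₂, R, w, rfl, hR, h1, h2⟩ := ih hk
    exact ⟨l₁, l₂ ++ [_], R, w, by simp, hR, h1, h2.step ha⟩
  | @sw l k' r' v h hb ih =>
    by_cases hk' : k < k'
    · obtain ⟨l₁, l₂, R, w, rfl, hR, h1, h2⟩ := ih hk'
      exact ⟨l₁, l₂, R, w, rfl, hR, h1, h2.sw hb⟩
    · have e : k = k' := by have := h.le; omega
      subst e
      exact ⟨l, [], r', v, by simp, hb, h, Run.nil⟩
  | weak _ hr ih =>
    obtain ⟨l₁, l₂, R, w, rfl, hR, h1, h2⟩ := ih hk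
    exact ⟨l₁, l₂, R, w, rfl, hR, h1, h2.weak hr⟩

/-- rotate a closed run -/
theorem Run.rotate {k r u l n} (h : Run D b k r u l (k + 2 * n) r u) (hn : 1 ≤ n)
    (hl : l.Nodup) : ∃ l' R w, l'.Nodup ∧ b ≤ R ∧ Run D b (k + 1) 0 w l' (k + 2 * n) R w := by
  obtain ⟨l₁, l₂, R, w, rfl, hR, h1, h2⟩ := h.split (by omega)
  exact ⟨l₂ ++ l₁, R, w, (List.perm_append_comm.nodup_iff).1 hl, hR, h2.trans (h1.shifts n)⟩

theorem Run.extract {k r u l k' r' v} (h : Run D b k r u l k' r' v) (hr : r = 0) :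
    ∃ (st : ℕ → ℕ) (c : ℕ → V), st 0 = 0 ∧ (∀ j, j < k' - k → st j + b ≤ st (j + 1)) ∧
      st (k' - k) + r' ≤ l.length ∧ c l.length = v ∧ c 0 = u ∧
      (∀ n (hn : n < l.length), c n = l[n]) ∧
      (∀ j, j < k' - k → ∀ n, st j ≤ n → n < st (j + 1) → Arc D (k + j) (c n) (c (n + 1))) ∧
      (∀ n, st (k' - k) ≤ n → n < l.length → Arc D k' (c n) (c (n + 1))) := by
  classical
  induction h with
  | nil => exact ⟨fun _ => 0, fun _ => u, rfl, by simp, by simp [hr], rfl, rfl, by simp, by simp, by simp⟩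
  | @step l k' r' v w h ha ih =>
    obtain ⟨st, c, h0, h1, h2, h3, h4, h5, h6, h7⟩ := ih
    have hmono : ∀ j, j ≤ k' - k → st j ≤ st (k' - k) := by
      intro j hj
      induction hd : (k' - k) - j generalizing j with
      | zero => rw [show j = k' - k by omega]
      | succ d ihd => have := h1 j (by omega); have := ihd (j+1) (by omega) (by omega); omega
    refine ⟨st, fun n => if n = l.length + 1 then w else c n, h0, h1, ?_, ?_, ?_, ?_, ?_, ?_⟩
    · simp; omega
    · simp
    · simpa using h4
    · intro n hn
      simp only [List.length_append, List.length_singleton] at hn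
      simp only
      rw [if_neg (by omega), List.getElem_append]
      split_ifs with h
      · exact h5 n h
      · simp; rw [show n = l.length by omega]; exact h3
    · intro j hj n hn hn'
      have := hmono (j+1) (by omega)
      simp only
      rw [if_neg (by omega), if_neg (by omega)]
      exact h6 j hj n hn hn'
    · intro n hn hn'
      simp at hn'
      simp only
      by_cases hx : n = l.length
      · subst hx; simp [h3]; exact ha
      · rw [if_neg (by omega), if_neg (by omega)]; exact h7 n hn (by omega)
  | @sw l k' r' v h hb ih =>
    obtain ⟨st, c, h0, h1, h2, h3, h4, h5, h6, h7⟩ := ih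
    have hle := h.le
    have e : k' + 1 - k = (k' - k) + 1 := by omega
    rw [e]
    refine ⟨fun j => if j = (k' - k) + 1 then l.length else st j, c, by simpa using h0, ?_, ?_, h3, h4, h5, ?_, ?_⟩
    · intro j hj
      simp only
      rw [if_neg (by omega)]
      split_ifs with h
      · have : j = k' - k := by omega
        subst this; omega
      · exact h1 j (by omega)
    · simp
    · intro j hj n hn hn'
      try simp only at hn hn'
      rw [if_neg (by omega)] at hn
      split_ifs at hn' with h
      · have : j = k' - k := by omega
        subst this
        have := h7 n hn hn'
        rwa [show k + (k' - k) = k' by omega]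
      · exact h6 j (by omega) n hn hn'
    · intro n hn hn'
      simp at hn; omega
  | weak _ hr ih =>
    obtain ⟨st, c, h0, h1, h2, h3⟩ := ih
    exact ⟨st, c, h0, h1, by omega, h3⟩

theorem Run.closed {a r u l} (h : Run D b 0 r u l (2 * a) r u) (ha : 2 ≤ a) (hb : 1 ≤ b)
    (hl : l.Nodup) : ContainsSubdivisionOf D (Cab a b) := by
  have h' : Run D b 0 r u l (0 + 2 * a) r u := by simpa using h
  obtain ⟨l', R, w, hl', hR, h1⟩ := h'.rotate (by omega) hl
  have h1 := h1.sw hR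
  rw [show 0 + 2 * a + 1 = (0 + 1) + 2 * a by omega] at h1
  obtain ⟨l'', R', w', hl'', hR', h2⟩ := h1.rotate (by omega) hl'
  obtain ⟨st, c, h0, h1, h2, h3, h4, h5, h6, h7⟩ := h2.extract rfl
  have e : 0 + 1 + 2 * a - (0 + 1 + 1) = 2 * a - 1 := by omega
  rw [e] at h1 h2 h6 h7
  refine core D a b l''.length ha hb c (fun j => if j = 2 * a then l''.length else st j) ?_ ?_ ?_ ?_ ?_ ?_
  · rw [if_neg (by omega)]; exact h0
  · simp
  · intro j hj
    try simp only
    rw [if_neg (by omega)]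
    split_ifs with h
    · have : j = 2 * a - 1 := by omega
      subst this; omega
    · exact h1 j (by omega)
  · intro i hi j hj hc
    rw [h5 i hi, h5 j hj] at hc
    exact (List.Nodup.getElem_inj_iff hl'').1 hc
  · rw [h3, h4]
  · intro j hj n hn hn'
    try simp only at hn hn'
    rw [if_neg (by omega)] at hn
    split_ifs at hn' with h
    · have : j = 2 * a - 1 := by omega
      subst this
      have := h7 n hn hn'
      rw [show 0 + 1 + 2 * a = (2 * a - 1) + 2 by omega] at this
      exact Arc_add_two.1 this
    · have := h6 j (by omega) n hn hn'
      rw [show 0 + 1 + 1 + j = j + 2 by omega] at this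
      exact Arc_add_two.1 this

/-- A directed path given as a function on `{0,…,L}`. -/
structure PathFn (D : V → V → Prop) (L : ℕ) (y : ℕ → V) : Prop where
  arc : ∀ i, i < L → D (y i) (y (i + 1))
  inj : ∀ i j, i ≤ L → j ≤ L → y i = y j → i = j

theorem exists_pathFn {P : List V} {u v : V} (h : IsDipathList D P) (hu : P.head? = some u)
    (hv : P.getLast? = some v) : ∃ (L : ℕ) (y : ℕ → V), P.length = L + 1 ∧ PathFn D L y ∧
      y 0 = u ∧ y L = v ∧ (∀ x, x ∈ P ↔ ∃ i, i ≤ L ∧ y i = x) ∧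
      (∀ i, i ≤ L → P[i]? = some (y i)) := by
  obtain ⟨hne, hnd, hch⟩ := h
  have hpos : 0 < P.length := List.length_pos_iff.2 hne
  have hget : ∀ i, i ≤ P.length - 1 → P[i]? = some (P.getD i u) := by
    intro i hi
    rw [List.getD_eq_getElem _ _ (by omega), List.getElem?_eq_getElem (by omega)]
  refine ⟨P.length - 1, fun i => P.getD i u, by omega, ⟨?_, ?_⟩, ?_, ?_, ?_, hget⟩
  · intro i hi
    have := (List.isChain_iff_getElem.1 hch) i (by omega)
    try simp only
    rwa [List.getD_eq_getElem _ _ (by omega), List.getD_eq_getElem _ _ (by omega)]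
  · intro i j hi hj
    try simp only
    rw [List.getD_eq_getElem _ _ (by omega), List.getD_eq_getElem _ _ (by omega)]
    exact (List.Nodup.getElem_inj_iff hnd).1
  · have := hget 0 (by omega)
    rw [← List.head?_eq_getElem?, hu] at this
    exact (Option.some.inj this).symm
  · have := hget (P.length - 1) le_rfl
    rw [← List.getLast?_eq_getElem?, hv] at this
    exact (Option.some.inj this).symm
  · intro x
    rw [List.mem_iff_getElem]
    constructor
    · rintro ⟨i, hi, rfl⟩
      exact ⟨i, by omega, by simp only; rw [List.getD_eq_getElem _ _ (by omega)]⟩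
    · rintro ⟨i, hi, rfl⟩
      exact ⟨i, by omega, by simp only; rw [List.getD_eq_getElem _ _ (by omega)]⟩

/-- `y i, …, y (j-1)` -/
def segF (y : ℕ → V) (i j : ℕ) : List V := (List.range' i (j - i)).map y
/-- `y j, …, y (i+1)` -/
def segB (y : ℕ → V) (i j : ℕ) : List V := ((List.range' (i + 1) (j - i)).map y).reverse

theorem mem_segF {y : ℕ → V} {i j : ℕ} {x : V} :
    x ∈ segF y i j ↔ ∃ n, i ≤ n ∧ n < j ∧ y n = x := by
  simp only [segF, List.mem_map, List.mem_range'_1]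
  constructor
  · rintro ⟨n, ⟨h1, h2⟩, h3⟩; exact ⟨n, h1, by omega, h3⟩
  · rintro ⟨n, h1, h2, h3⟩; exact ⟨n, ⟨h1, by omega⟩, h3⟩

theorem mem_segB {y : ℕ → V} {i j : ℕ} {x : V} :
    x ∈ segB y i j ↔ ∃ n, i < n ∧ n ≤ j ∧ y n = x := by
  simp only [segB, List.mem_reverse, List.mem_map, List.mem_range'_1]
  constructor
  · rintro ⟨n, ⟨h1, h2⟩, h3⟩; exact ⟨n, h1, by omega, h3⟩
  · rintro ⟨n, h1, h2, h3⟩; exact ⟨n, ⟨h1, by omega⟩, h3⟩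

theorem PathFn.nodup_segF {L : ℕ} {y : ℕ → V} (h : PathFn D L y) {i j : ℕ} (hj : j ≤ L + 1) :
    (segF y i j).Nodup := by
  refine List.Nodup.map_on ?_ List.nodup_range'
  intro x hx z hz
  rw [List.mem_range'_1] at hx hz
  exact h.inj x z (by omega) (by omega)

theorem PathFn.nodup_segB {L : ℕ} {y : ℕ → V} (h : PathFn D L y) {i j : ℕ} (hj : j ≤ L) :
    (segB y i j).Nodup := by
  rw [segB, List.nodup_reverse]
  refine List.Nodup.map_on ?_ List.nodup_range'
  intro x hx z hz
  rw [List.mem_range'_1] at hx hz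
  exact h.inj x z (by omega) (by omega)

theorem PathFn.runF {L : ℕ} {y : ℕ → V} (h : PathFn D L y) {i j k r : ℕ} (hij : i ≤ j)
    (hj : j ≤ L) (hk : k % 2 = 0) : Run D b k r (y i) (segF y i j) k (r + (j - i)) (y j) := by
  induction j, hij using Nat.le_induction with
  | base => simpa [segF] using Run.nil
  | succ j hij ih =>
    have h1 := (ih (by omega)).step (w := y (j+1)) (by simp only [Arc, if_pos hk]; exact h.arc j (by omega))
    have e : segF y i (j+1) = segF y i j ++ [y j] := by
      simp only [segF]
      rw [show j + 1 - i = (j - i) + 1 by omega, List.range'_concat, List.map_append]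
      simp; congr 1; omega
    rw [e, show r + (j + 1 - i) = r + (j - i) + 1 by omega]
    exact h1

theorem PathFn.runB {L : ℕ} {y : ℕ → V} (h : PathFn D L y) {i j k r : ℕ} (hij : i ≤ j)
    (hj : j ≤ L) (hk : k % 2 = 1) : Run D b k r (y j) (segB y i j) k (r + (j - i)) (y i) := by
  obtain ⟨d, rfl⟩ := Nat.exists_eq_add_of_le hij
  induction d generalizing i with
  | zero => simpa [segB] using Run.nil
  | succ d ih =>
    have h0 := ih (i := i + 1) (by omega) (by omega)
    have h1 := h0.step (w := y i) (by simp only [Arc]; rw [if_neg (by omega)]; exact h.arc i (by omega))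
    have e : segB y i (i + (d + 1)) = segB y (i+1) (i + 1 + d) ++ [y (i+1)] := by
      simp only [segB]
      rw [show i + (d + 1) - i = d + 1 by omega, List.range'_succ, show i + 1 + d - (i + 1) = d by omega]
      simp
    rw [show i + 1 + d - (i + 1) = d by omega, show i + 1 + d = i + (d+1) by omega] at h1
    rw [e, show r + (i + (d + 1) - i) = r + d + 1 by omega, show i + 1 + d = i + (d+1) by omega]
    exact h1

theorem Run.fstep {k r u l k' r' v w} (h : Run D b k r u l k' r' v) (hk : k' % 2 = 0) (ha : D v w) :
    Run D b k r u (l ++ [v]) k' (r' + 1) w := h.step (by simp only [Arc, if_pos hk]; exact ha)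

theorem Run.bstep {k r u l k' r' v w} (h : Run D b k r u l k' r' v) (hk : k' % 2 = 1) (ha : D w v) :
    Run D b k r u (l ++ [v]) k' (r' + 1) w :=
  h.step (by simp only [Arc]; rw [if_neg (by omega)]; exact ha)

end Paper
namespace Paper
variable {V : Type*} {D : V → V → Prop} {b : ℕ}

/-- Functional description of the nontrivial gadgets. -/
inductive GD (D : V → V → Prop) (b : ℕ) (p q : V) (X : Set V) : Prop
  | I (L : ℕ) (y : ℕ → V) (hy : PathFn D L y) (h0 : y 0 = q) (hL : y L = p) (hpq : D p q)
      (hlen : 4 * b ^ 2 ≤ L + 1) (hX : ∀ x, x ∈ X ↔ ∃ i, i ≤ L ∧ y i = x)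
  | II (L : ℕ) (y : ℕ → V) (hy : PathFn D L y) (hL : y L = p)
      (hlen : 2 * b ^ 2 + b ≤ L + 2) (hq : ∀ i, i ≤ L → y i ≠ q) (hto : ∀ i, i ≤ L → D (y i) q)
      (hX : ∀ x, x ∈ X ↔ x = q ∨ ∃ i, i ≤ L ∧ y i = x)
  | III (L₁ L₂ : ℕ) (y₁ y₂ : ℕ → V) (hy₁ : PathFn D L₁ y₁) (hy₂ : PathFn D L₂ y₂)
      (h1 : y₁ 0 = p) (h2 : y₂ 0 = q) (hr : y₁ L₁ = y₂ L₂)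
      (hlen₁ : 2 * b ≤ L₁ + 1) (hlen₂ : 2 * b ≤ L₂ + 1)
      (hdisj : ∀ i j, i ≤ L₁ → j ≤ L₂ → y₁ i = y₂ j → i = L₁ ∧ j = L₂)
      (hX : ∀ x, x ∈ X ↔ (∃ i, i ≤ L₁ ∧ y₁ i = x) ∨ ∃ i, i ≤ L₂ ∧ y₂ i = x)

theorem ChainGadget.toGD (G : ChainGadget D b) : GD D b G.pp G.qq G.verts := by
  cases G with
  | I G =>
    have hch : List.IsChain D (G.p :: G.q :: (G.rest ++ [G.p])) := G.chain
    have hpath : IsDipathList D (G.q :: (G.rest ++ [G.p])) := by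
      refine ⟨by simp, ?_, ?_⟩
      · have h := G.nodup
        have : (G.q :: (G.rest ++ [G.p])).Perm (G.p :: G.q :: G.rest) := by
          have := List.perm_append_comm (l₁ := G.q :: G.rest) (l₂ := [G.p])
          simpa using this
        exact this.nodup_iff.2 h
      · exact (List.isChain_cons_cons.1 hch).2
    obtain ⟨L, y, hl, hy, h0, hL, hmem, -⟩ := exists_pathFn (u := G.q) (v := G.p) hpath (by simp)
      (by rw [← List.cons_append]; exact List.getLast?_concat)
    refine GD.I L y hy h0 hL (List.isChain_cons_cons.1 hch).1 ?_ ?_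
    · have := G.glen; simp at hl; omega
    · intro x
      rw [← hmem]
      change x ∈ G.p :: G.q :: G.rest ↔ _
      simp; tauto
  | II G =>
    obtain ⟨L, y, hl, hy, h0, hL, hmem, -⟩ := exists_pathFn G.path₁ G.first₁ G.last₁
    refine GD.II L y hy hL ?_ ?_ ?_ ?_
    · have := G.len₁; omega
    · intro i hi h; exact G.hq ((hmem _).2 ⟨i, hi, h⟩)
    · intro i hi; exact G.toq _ ((hmem _).2 ⟨i, hi, rfl⟩)
    · intro x; rw [← hmem]; rfl
  | III G =>
    obtain ⟨L, y, hl, hy, h0, hL, hmem, -⟩ := exists_pathFn G.path₁ G.first₁ G.last₁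
    obtain ⟨L', y', hl', hy', h0', hL', hmem', -⟩ := exists_pathFn G.path₂ G.first₂ G.last₂
    refine GD.III L L' y y' hy hy' h0 h0' (hL.trans hL'.symm) ?_ ?_ ?_ ?_
    · have := G.len₁; omega
    · have := G.len₂; omega
    · intro i j hi hj e
      have := G.inter (y i) ((hmem _).2 ⟨i, hi, rfl⟩) ((hmem' _).2 ⟨j, hj, e.symm⟩)
      exact ⟨hy.inj _ _ hi le_rfl (this.trans hL.symm),
        hy'.inj _ _ hj le_rfl (e.symm.trans (this.trans hL'.symm))⟩
    · intro x; rw [← hmem, ← hmem']; rfl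

theorem GD.detour {p q : V} {X : Set V} (h : GD D b p q X) (hb : 1 ≤ b) :
    ∃ l, Run D b 0 b p l 2 0 q ∧ l.Nodup ∧ (∀ x ∈ l, x ∈ X) ∧ q ∉ l := by
  cases h with
  | I L y hy h0 hL hpq hlen hX =>
    have hbL : b ≤ L := by nlinarith
    refine ⟨segB y 0 L, ?_, hy.nodup_segB le_rfl, ?_, ?_⟩
    · have h1 : Run D b 0 b p [] 1 0 p := Run.nil.sw le_rfl
      have h2 := h1.trans (hL ▸ hy.runB (Nat.zero_le L) le_rfl rfl)
      rw [h0] at h2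
      exact h2.sw (by omega)
    · intro x hx; obtain ⟨n, -, h2, rfl⟩ := mem_segB.1 hx; exact (hX _).2 ⟨n, h2, rfl⟩
    · intro hx; obtain ⟨n, h1, h2, h3⟩ := mem_segB.1 hx
      have := hy.inj n 0 h2 (by omega) (h3.trans h0.symm); omega
  | II L y hy hL hlen hq hto hX =>
    have hbL : b ≤ L := by nlinarith
    refine ⟨segB y 0 L ++ [y 0], ?_, ?_, ?_, ?_⟩
    · have h1 : Run D b 0 b p [] 1 0 p := Run.nil.sw le_rfl
      have h2 := h1.trans (hL ▸ hy.runB (Nat.zero_le L) le_rfl rfl)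
      have h3 := (h2.sw (by omega)).fstep rfl (hto 0 (by omega))
      exact h3.weak (Nat.zero_le _)
    · rw [List.nodup_append]
      refine ⟨hy.nodup_segB le_rfl, by simp, ?_⟩
      intro x hx z hz e
      obtain ⟨n, h1, h2, h3⟩ := mem_segB.1 hx
      simp at hz
      have := hy.inj n 0 h2 (by omega) (h3.trans (e.trans hz)); omega
    · intro x hx
      rw [hX]
      right
      rcases List.mem_append.1 hx with hx | hx
      · obtain ⟨n, -, h2, rfl⟩ := mem_segB.1 hx; exact ⟨n, h2, rfl⟩
      · simp at hx; exact ⟨0, by omega, hx.symm⟩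
    · intro hx
      rcases List.mem_append.1 hx with hx | hx
      · obtain ⟨n, h1, h2, h3⟩ := mem_segB.1 hx
        exact hq n h2 h3
      · simp at hx; exact hq 0 (by omega) hx.symm
  | III L₁ L₂ y₁ y₂ hy₁ hy₂ h1 h2 hr hlen₁ hlen₂ hdisj hX =>
    refine ⟨segF y₁ 0 L₁ ++ segB y₂ 0 L₂, ?_, ?_, ?_, ?_⟩
    · have h3 : Run D b 0 b p (segF y₁ 0 L₁) 0 (b + (L₁ - 0)) (y₁ L₁) :=
        h1 ▸ hy₁.runF (Nat.zero_le _) le_rfl rfl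
      have h4 := h3.sw (by omega)
      rw [hr] at h4
      have h5 := h4.trans (hy₂.runB (Nat.zero_le L₂) le_rfl rfl)
      rw [h2] at h5
      exact h5.sw (by omega)
    · rw [List.nodup_append]
      refine ⟨hy₁.nodup_segF (by omega), hy₂.nodup_segB le_rfl, ?_⟩
      rintro x hx z hz rfl
      obtain ⟨n, h3, h4, h5⟩ := mem_segF.1 hx
      obtain ⟨n', h6, h7, h8⟩ := mem_segB.1 hz
      have := hdisj n n' (by omega) h7 (h5.trans h8.symm); omega
    · intro x hx
      rw [hX]
      rcases List.mem_append.1 hx with hx | hx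
      · obtain ⟨n, h3, h4, h5⟩ := mem_segF.1 hx; exact Or.inl ⟨n, by omega, h5⟩
      · obtain ⟨n, h3, h4, h5⟩ := mem_segB.1 hx; exact Or.inr ⟨n, by omega, h5⟩
    · intro hx
      rcases List.mem_append.1 hx with hx | hx
      · obtain ⟨n, h3, h4, h5⟩ := mem_segF.1 hx
        have := hdisj n 0 (by omega) (by omega) (h5.trans h2.symm); omega
      · obtain ⟨n, h3, h4, h5⟩ := mem_segB.1 hx
        have := hy₂.inj n 0 h4 (by omega) (h5.trans h2.symm); omega

/-- From `x` in state `(k,r)` one can, inside `X`, reach `z₀` or `z₁`. -/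
def Ex (D : V → V → Prop) (b : ℕ) (X : Set V) (z₀ z₁ : V) (K k r : ℕ) (x : V) : Prop :=
  ∃ l k' t, k' % 2 = 0 ∧ k' ≤ K ∧ Run D b k r x l k' 0 t ∧ l.Nodup ∧ (∀ y ∈ l, y ∈ X) ∧
    z₁ ∉ l ∧ t ∉ l ∧ (t = z₀ ∨ t = z₁)

theorem Ex.nil0 {X : Set V} {z₀ z₁ t : V} {r : ℕ} (ht : t = z₀ ∨ t = z₁) :
    Ex D b X z₀ z₁ 2 0 r t :=
  ⟨[], 0, t, rfl, by omega, Run.nil.weak (Nat.zero_le _), by simp, by simp, by simp, by simp, ht⟩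

theorem Ex.nil1 {X : Set V} {z₀ z₁ t : V} (ht : t = z₀ ∨ t = z₁) (hb : b ≤ 1) :
    Ex D b X z₀ z₁ 2 1 1 t :=
  ⟨[], 2, t, rfl, by omega, Run.nil.sw hb, by simp, by simp, by simp, by simp, ht⟩

theorem Ex.mono {X : Set V} {z₀ z₁ x : V} {K k r R : ℕ} (h : Ex D b X z₀ z₁ K k r x)
    (hR : r ≤ R) : Ex D b X z₀ z₁ K k R x := by
  obtain ⟨l, k', t, h1, h2, h3, h4⟩ := h
  exact ⟨l, k', t, h1, h2, h3.mono hR, h4⟩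

theorem Ex.shift {X : Set V} {z₀ z₁ x : V} {K k r : ℕ} (h : Ex D b X z₀ z₁ K k r x) :
    Ex D b X z₀ z₁ (K + 2) (k + 2) r x := by
  obtain ⟨l, k', t, h1, h2, h3, h4⟩ := h
  exact ⟨l, k' + 2, t, by omega, by omega, h3.shift, h4⟩

/-- The facts on the first gadget that are used later. -/
def FirstOK (D : V → V → Prop) (b : ℕ) (X : Set V) (z₀ z₁ : V) : Prop :=
  ∃ Bad : List V, Bad.length ≤ 2 * b - 2 ∧ ∀ x ∈ X, Ex D b X z₀ z₁ 2 0 b x ∧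
    (Ex D b X z₀ z₁ 2 1 1 x ∨ (x ∈ Bad ∧ Ex D b X z₀ z₁ 2 0 0 x))

theorem firstOK_triv {z₀ z₁ : V} (hb : 1 ≤ b) : FirstOK D b {z₀, z₁} z₀ z₁ := by
  by_cases h : b = 1
  · refine ⟨[], by simp, fun x hx => ?_⟩
    have hx : x = z₀ ∨ x = z₁ := hx
    exact ⟨Ex.nil0 hx, Or.inl (Ex.nil1 hx (by omega))⟩
  · refine ⟨[z₀, z₁], by simp; omega, fun x hx => ?_⟩
    have hx : x = z₀ ∨ x = z₁ := hx
    exact ⟨Ex.nil0 hx, Or.inr ⟨by simpa using hx, Ex.nil0 hx⟩⟩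

theorem length_segF {y : ℕ → V} {i j : ℕ} : (segF y i j).length = j - i := by simp [segF]

theorem GD.firstOK {p q : V} {X : Set V} (h : GD D b p q X) (hb : 1 ≤ b) :
    FirstOK D b X p q := by
  cases h with
  | I L y hy h0 hL hpq hlen hX =>
    have hbL : b ≤ L := by nlinarith
    have hE2 : ∀ i, i ≤ L → Ex D b X p q 2 0 0 (y i) := by
      intro i hi
      by_cases hi0 : i = 0
      · subst hi0; rw [h0]; exact Ex.nil0 (Or.inr rfl)
      have hq : q ∉ segF y i (L + 1) := by
        intro hx
        obtain ⟨n, h1, h2, h3⟩ := mem_segF.1 hx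
        have := hy.inj n 0 (by omega) (by omega) (h3.trans h0.symm); omega
      have e : segF y i (L + 1) = segF y i L ++ [p] := by
        simp only [segF]
        rw [show L + 1 - i = (L - i) + 1 by omega, List.range'_concat, List.map_append]
        simp; rw [← hL]; congr 1; omega
      refine ⟨segF y i (L + 1), 0, q, rfl, by omega, ?_, hy.nodup_segF le_rfl, ?_, hq, hq, Or.inr rfl⟩
      · have h1 := hy.runF (b := b) (k := 0) (r := 0) hi le_rfl rfl
        rw [hL] at h1
        rw [e]
        exact (h1.fstep rfl hpq).weak (Nat.zero_le _)
      · intro x hx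
        obtain ⟨n, h1, h2, h3⟩ := mem_segF.1 hx
        exact (hX x).2 ⟨n, by omega, h3⟩
    refine ⟨segF y 0 (b - 1), by rw [length_segF]; omega, fun x hx => ?_⟩
    obtain ⟨i, hi, rfl⟩ := (hX x).1 hx
    refine ⟨(hE2 i hi).mono (Nat.zero_le _), ?_⟩
    by_cases hib : i < b - 1
    · exact Or.inr ⟨mem_segF.2 ⟨i, by omega, hib, rfl⟩, hE2 i hi⟩
    · left
      have hq : q ∉ segB y 0 i := by
        intro hx
        obtain ⟨n, h1, h2, h3⟩ := mem_segB.1 hx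
        have := hy.inj n 0 (by omega) (by omega) (h3.trans h0.symm); omega
      refine ⟨segB y 0 i, 2, q, rfl, le_rfl, ?_, hy.nodup_segB hi, ?_, hq, hq, Or.inr rfl⟩
      · have h1 := hy.runB (b := b) (k := 1) (r := 1) (Nat.zero_le i) hi rfl
        rw [h0] at h1
        exact h1.sw (by omega)
      · intro x hx
        obtain ⟨n, h1, h2, h3⟩ := mem_segB.1 hx
        exact (hX x).2 ⟨n, by omega, h3⟩
  | II L y hy hL hlen hq hto hX =>
    have hE2 : ∀ i, i ≤ L → Ex D b X p q 2 0 0 (y i) := by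
      intro i hi
      have hq' : q ∉ [y i] := by simp; exact fun h => hq i hi h.symm
      refine ⟨[y i], 0, q, rfl, by omega, ?_, by simp, ?_, hq', hq', Or.inr rfl⟩
      · exact (Run.nil.fstep rfl (hto i hi)).weak (Nat.zero_le _)
      · intro x hx
        simp at hx
        exact (hX x).2 (Or.inr ⟨i, hi, hx.symm⟩)
    have hE4 : ∀ i, i ≤ L → b - 1 ≤ i → Ex D b X p q 2 1 1 (y i) := by
      intro i hi hib
      have hall : ∀ x ∈ segB y 0 i ++ [y 0], ∃ n, n ≤ L ∧ y n = x := by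
        intro x hx
        rcases List.mem_append.1 hx with hx | hx
        · obtain ⟨n, -, h2, rfl⟩ := mem_segB.1 hx; exact ⟨n, by omega, rfl⟩
        · simp at hx; exact ⟨0, by omega, hx.symm⟩
      have hq' : q ∉ segB y 0 i ++ [y 0] := by
        intro hx
        obtain ⟨n, h1, h2⟩ := hall q hx
        exact hq n h1 h2
      refine ⟨segB y 0 i ++ [y 0], 2, q, rfl, le_rfl, ?_, ?_, ?_, hq', hq', Or.inr rfl⟩
      · have h1 := hy.runB (b := b) (k := 1) (r := 1) (Nat.zero_le i) hi rfl
        exact ((h1.sw (by omega)).fstep rfl (hto 0 (by omega))).weak (Nat.zero_le _)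
      · rw [List.nodup_append]
        refine ⟨hy.nodup_segB hi, by simp, ?_⟩
        intro x hx z hz e
        obtain ⟨n, h1, h2, h3⟩ := mem_segB.1 hx
        simp at hz
        have := hy.inj n 0 (by omega) (by omega) (h3.trans (e.trans hz)); omega
      · intro x hx; exact (hX x).2 (Or.inr (hall x hx))
    by_cases hb1 : b = 1
    · refine ⟨[], by simp, fun x hx => ?_⟩
      rcases (hX x).1 hx with rfl | ⟨i, hi, rfl⟩
      · exact ⟨Ex.nil0 (Or.inr rfl), Or.inl (Ex.nil1 (Or.inr rfl) (by omega))⟩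
      · exact ⟨(hE2 i hi).mono (Nat.zero_le _), Or.inl (hE4 i hi (by omega))⟩
    · refine ⟨q :: segF y 0 (b - 1), by rw [List.length_cons, length_segF]; omega, fun x hx => ?_⟩
      rcases (hX x).1 hx with rfl | ⟨i, hi, rfl⟩
      · exact ⟨Ex.nil0 (Or.inr rfl), Or.inr ⟨by simp, Ex.nil0 (Or.inr rfl)⟩⟩
      · refine ⟨(hE2 i hi).mono (Nat.zero_le _), ?_⟩
        by_cases hib : i < b - 1
        · exact Or.inr ⟨List.mem_cons_of_mem _ (mem_segF.2 ⟨i, by omega, hib, rfl⟩), hE2 i hi⟩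
        · exact Or.inl (hE4 i hi (by omega))
  | III L₁ L₂ y₁ y₂ hy₁ hy₂ h1 h2 hr hlen₁ hlen₂ hdisj hX =>
    have hF1 : ∀ r i, i ≤ L₁ → b ≤ r + (L₁ - i) → Ex D b X p q 2 0 r (y₁ i) := by
      intro r i hi hri
      have hq : q ∉ segF y₁ i L₁ ++ segB y₂ 0 L₂ := by
        intro hx
        rcases List.mem_append.1 hx with hx | hx
        · obtain ⟨n, h3, h4, h5⟩ := mem_segF.1 hx
          have := hdisj n 0 (by omega) (by omega) (h5.trans h2.symm); omega
        · obtain ⟨n, h3, h4, h5⟩ := mem_segB.1 hx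
          have := hy₂.inj n 0 h4 (by omega) (h5.trans h2.symm); omega
      refine ⟨segF y₁ i L₁ ++ segB y₂ 0 L₂, 2, q, rfl, le_rfl, ?_, ?_, ?_, hq, hq, Or.inr rfl⟩
      · have h4 := (hy₁.runF (b := b) (k := 0) (r := r) hi le_rfl rfl).sw hri
        rw [hr] at h4
        have h5 := h4.trans (hy₂.runB (Nat.zero_le L₂) le_rfl rfl)
        rw [h2] at h5
        exact h5.sw (by omega)
      · rw [List.nodup_append]
        refine ⟨hy₁.nodup_segF (by omega), hy₂.nodup_segB le_rfl, ?_⟩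
        rintro x hx z hz rfl
        obtain ⟨n, h3, h4, h5⟩ := mem_segF.1 hx
        obtain ⟨n', h6, h7, h8⟩ := mem_segB.1 hz
        have := hdisj n n' (by omega) h7 (h5.trans h8.symm); omega
      · intro x hx
        rw [hX]
        rcases List.mem_append.1 hx with hx | hx
        · obtain ⟨n, h3, h4, h5⟩ := mem_segF.1 hx; exact Or.inl ⟨n, by omega, h5⟩
        · obtain ⟨n, h3, h4, h5⟩ := mem_segB.1 hx; exact Or.inr ⟨n, by omega, h5⟩
    have hF2 : ∀ r i, i ≤ L₂ → b ≤ r + (L₂ - i) → Ex D b X p q 2 0 r (y₂ i) := by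
      intro r i hi hri
      by_cases hi0 : i = 0
      · subst hi0; rw [h2]; exact Ex.nil0 (Or.inr rfl)
      have hq : q ∉ segF y₂ i L₂ ++ segB y₁ 0 L₁ := by
        intro hx
        rcases List.mem_append.1 hx with hx | hx
        · obtain ⟨n, h3, h4, h5⟩ := mem_segF.1 hx
          have := hy₂.inj n 0 (by omega) (by omega) (h5.trans h2.symm); omega
        · obtain ⟨n, h3, h4, h5⟩ := mem_segB.1 hx
          have := hdisj n 0 (by omega) (by omega) (h5.trans h2.symm); omega
      have hp : p ∉ segF y₂ i L₂ ++ segB y₁ 0 L₁ := by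
        intro hx
        rcases List.mem_append.1 hx with hx | hx
        · obtain ⟨n, h3, h4, h5⟩ := mem_segF.1 hx
          have := hdisj 0 n (by omega) (by omega) (h1.trans h5.symm); omega
        · obtain ⟨n, h3, h4, h5⟩ := mem_segB.1 hx
          have := hy₁.inj n 0 (by omega) (by omega) (h5.trans h1.symm); omega
      refine ⟨segF y₂ i L₂ ++ segB y₁ 0 L₁, 2, p, rfl, le_rfl, ?_, ?_, ?_, hq, hp, Or.inl rfl⟩
      · have h4 := (hy₂.runF (b := b) (k := 0) (r := r) hi le_rfl rfl).sw hri
        rw [← hr] at h4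
        have h5 := h4.trans (hy₁.runB (Nat.zero_le L₁) le_rfl rfl)
        rw [h1] at h5
        exact h5.sw (by omega)
      · rw [List.nodup_append]
        refine ⟨hy₂.nodup_segF (by omega), hy₁.nodup_segB le_rfl, ?_⟩
        rintro x hx z hz rfl
        obtain ⟨n, h3, h4, h5⟩ := mem_segF.1 hx
        obtain ⟨n', h6, h7, h8⟩ := mem_segB.1 hz
        have := hdisj n' n (by omega) (by omega) (h8.trans h5.symm); omega
      · intro x hx
        rw [hX]
        rcases List.mem_append.1 hx with hx | hx
        · obtain ⟨n, h3, h4, h5⟩ := mem_segF.1 hx; exact Or.inr ⟨n, by omega, h5⟩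
        · obtain ⟨n, h3, h4, h5⟩ := mem_segB.1 hx; exact Or.inl ⟨n, by omega, h5⟩
    have hG1 : ∀ i, i ≤ L₁ → b - 1 ≤ i → Ex D b X p q 2 1 1 (y₁ i) := by
      intro i hi hib
      have hq : q ∉ segB y₁ 0 i := by
        intro hx
        obtain ⟨n, h3, h4, h5⟩ := mem_segB.1 hx
        have := hdisj n 0 (by omega) (by omega) (h5.trans h2.symm); omega
      have hp : p ∉ segB y₁ 0 i := by
        intro hx
        obtain ⟨n, h3, h4, h5⟩ := mem_segB.1 hx
        have := hy₁.inj n 0 (by omega) (by omega) (h5.trans h1.symm); omega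
      refine ⟨segB y₁ 0 i, 2, p, rfl, le_rfl, ?_, hy₁.nodup_segB hi, ?_, hq, hp, Or.inl rfl⟩
      · have h3 := hy₁.runB (b := b) (k := 1) (r := 1) (Nat.zero_le i) hi rfl
        rw [h1] at h3
        exact h3.sw (by omega)
      · intro x hx
        obtain ⟨n, h3, h4, h5⟩ := mem_segB.1 hx
        exact (hX x).2 (Or.inl ⟨n, by omega, h5⟩)
    have hG2 : ∀ i, i ≤ L₂ → b - 1 ≤ i → Ex D b X p q 2 1 1 (y₂ i) := by
      intro i hi hib
      have hq : q ∉ segB y₂ 0 i := by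
        intro hx
        obtain ⟨n, h3, h4, h5⟩ := mem_segB.1 hx
        have := hy₂.inj n 0 (by omega) (by omega) (h5.trans h2.symm); omega
      refine ⟨segB y₂ 0 i, 2, q, rfl, le_rfl, ?_, hy₂.nodup_segB hi, ?_, hq, hq, Or.inr rfl⟩
      · have h3 := hy₂.runB (b := b) (k := 1) (r := 1) (Nat.zero_le i) hi rfl
        rw [h2] at h3
        exact h3.sw (by omega)
      · intro x hx
        obtain ⟨n, h3, h4, h5⟩ := mem_segB.1 hx
        exact (hX x).2 (Or.inr ⟨n, by omega, h5⟩)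
    refine ⟨segF y₁ 0 (b - 1) ++ segF y₂ 0 (b - 1),
      by rw [List.length_append, length_segF, length_segF]; omega, fun x hx => ?_⟩
    rcases (hX x).1 hx with ⟨i, hi, rfl⟩ | ⟨i, hi, rfl⟩
    · refine ⟨hF1 b i hi (by omega), ?_⟩
      by_cases hib : i < b - 1
      · exact Or.inr ⟨List.mem_append_left _ (mem_segF.2 ⟨i, by omega, hib, rfl⟩), hF1 0 i hi (by omega)⟩
      · exact Or.inl (hG1 i hi (by omega))
    · refine ⟨hF2 b i hi (by omega), ?_⟩
      by_cases hib : i < b - 1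
      · exact Or.inr ⟨List.mem_append_right _ (mem_segF.2 ⟨i, by omega, hib, rfl⟩), hF2 0 i hi (by omega)⟩
      · exact Or.inl (hG2 i hi (by omega))

end Paper
namespace Paper
variable {V : Type*} {D : V → V → Prop} {b : ℕ}

theorem nodup_app {l l' : List V} (h : l.Nodup) (h' : l'.Nodup) (hd : ∀ x ∈ l', x ∉ l) :
    (l ++ l').Nodup := by
  rw [List.nodup_append]
  refine ⟨h, h', ?_⟩
  rintro x hx z hz rfl
  exact hd x hz hx

theorem counting {X : Set V} {Bad : List V} (hBad : Bad.length ≤ 2 * b - 2) (hb : 1 ≤ b)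
    {L : ℕ} {y : ℕ → V} (hy : PathFn D L y) (hlen : 2 * b ^ 2 + b ≤ L + 2)
    (hbad : ∀ i, i ≤ L → y i ∈ X → y i ∈ Bad)
    (hgap : ∀ i, i + b ≤ L → y i ∈ X → ∃ n, i < n ∧ n < i + b ∧ y n ∈ X) :
    ∀ i, i < b → y i ∉ X := by
  classical
  intro i₀ hi₀ hX
  obtain ⟨c, rfl⟩ : ∃ c, b = c + 1 := ⟨b - 1, by omega⟩
  have hL : 2 * (c * c) + 5 * c + 1 ≤ L := by nlinarith
  let S : ℕ → Finset ℕ := fun N => (Finset.range (N + 1)).filter (fun n => y n ∈ X)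
  have claim : ∀ t, t ≤ 2 * c → t + 1 ≤ (S (i₀ + t * c)).card := by
    intro t
    induction t with
    | zero =>
      intro _
      have : i₀ ∈ S (i₀ + 0 * c) := by simp [S, hX]
      exact Finset.card_pos.2 ⟨_, this⟩
    | succ t ih =>
      intro ht
      have h1 := ih (by omega)
      have hne : (S (i₀ + t * c)).Nonempty := Finset.card_pos.1 (by omega)
      let n := (S (i₀ + t * c)).max' hne
      have hn : n ∈ S (i₀ + t * c) := Finset.max'_mem _ _
      have hn' := hn
      simp only [S, Finset.mem_filter, Finset.mem_range] at hn'
      have htc : t * c ≤ (2 * c) * c := Nat.mul_le_mul_right _ (by omega)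
      obtain ⟨n', h2, h3, h4⟩ := hgap n (by nlinarith) hn'.2
      have h5 : n' ∉ S (i₀ + t * c) := fun h => by
        have := Finset.le_max' _ _ h
        change n' ≤ n at this
        omega
      have h6 : insert n' (S (i₀ + t * c)) ⊆ S (i₀ + (t + 1) * c) := by
        have e : (t + 1) * c = t * c + c := by ring
        intro x hx
        rcases Finset.mem_insert.1 hx with rfl | hx
        · simp only [S, Finset.mem_filter, Finset.mem_range]
          exact ⟨by omega, h4⟩
        · simp only [S, Finset.mem_filter, Finset.mem_range] at hx ⊢
          exact ⟨by omega, hx.2⟩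
      have h7 := Finset.card_le_card h6
      rw [Finset.card_insert_of_notMem h5] at h7
      omega
  have h1 := claim (2 * c) le_rfl
  have hle : i₀ + 2 * c * c ≤ L := by nlinarith
  have h2 : (S (i₀ + 2 * c * c)).image y ⊆ Bad.toFinset := by
    intro x hx
    obtain ⟨n, hn, rfl⟩ := Finset.mem_image.1 hx
    simp only [S, Finset.mem_filter, Finset.mem_range] at hn
    rw [List.mem_toFinset]
    exact hbad n (by omega) hn.2
  have h3 := Finset.card_le_card h2
  rw [Finset.card_image_of_injOn] at h3
  · have := List.toFinset_card_le Bad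
    omega
  · intro n hn n' hn' e
    simp only [S, Finset.coe_filter, Finset.mem_range, Set.mem_setOf_eq] at hn hn'
    exact hy.inj n n' (by omega) (by omega) e

theorem star {X : Set V} {z₀ z₁ zs : V} (hF : FirstOK D b X z₀ z₁) (hb : 1 ≤ b)
    {L M : ℕ} {y u : ℕ → V} (hy : PathFn D L y) (hlen : 2 * b ^ 2 + b ≤ L + 2)
    (hto : ∀ i, i ≤ L → D (y i) zs) (hzs : ∀ i, i ≤ L → y i ≠ zs)
    (hu : PathFn D M u) (hM : b ≤ M) (hur : u M = y 0)
    (hdis : ∀ i j, i ≤ L → j ≤ M → y i = u j → i = 0 ∧ j = M)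
    (hzs2 : ∀ j, j ≤ M → u j ≠ zs)
    (hextra : D (u 0) (y 1) ∨ ∃ k, 1 ≤ k ∧ k ≤ L ∧ D (y k) (u 0))
    (hzsX : zs ∉ X) (hLX : y L ∉ X) (hmeet : (∃ i, i ≤ L ∧ y i ∈ X) ∨ ∃ j, j ≤ M ∧ u j ∈ X) :
    ∃ l x k r, x ∈ X ∧ Run D b 0 b (y L) l k r x ∧ l.Nodup ∧
      (∀ v ∈ l, v ∉ X ∧ (v = zs ∨ (∃ i, i ≤ L ∧ y i = v) ∨ ∃ j, j ≤ M ∧ u j = v)) ∧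
      Ex D b X z₀ z₁ 4 k r x := by
  classical
  have hbL : b ≤ L := by nlinarith
  obtain ⟨Bad, hBad, hE⟩ := hF
  have exK : ∀ {k r x}, Ex D b X z₀ z₁ 2 k r x → Ex D b X z₀ z₁ 4 k r x := by
    rintro k r x ⟨l, k', t, h1, h2, h3⟩
    exact ⟨l, k', t, h1, by omega, h3⟩
  have hE3 : ∀ x ∈ X, Ex D b X z₀ z₁ 4 1 b x := by
    intro x hx
    rcases (hE x hx).2 with h | ⟨-, h⟩
    · exact exK (h.mono hb)
    · obtain ⟨l, k', t, h1, h2, h3, h4⟩ := h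
      refine ⟨l, k' + 2, t, by omega, by omega, ?_, h4⟩
      have h5 : Run D b 1 b x [] 2 0 x := Run.nil.sw le_rfl
      exact h5.trans h3.shift
  have hbase : ∀ i, i ≤ L → Run D b 0 b (y L) [y L, zs] 1 1 (y i) := by
    intro i hi
    have h1 : Run D b 0 b (y L) [y L] 0 (b + 1) zs := Run.nil.fstep rfl (hto L le_rfl)
    exact (h1.sw (by omega)).bstep rfl (hto i hi)
  have nbase : [y L, zs].Nodup := by simpa using hzs L le_rfl
  have dy : ∀ n, n < L → y n ∉ [y L, zs] := by
    intro n hn h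
    simp at h
    rcases h with h | h
    · have := hy.inj n L hn.le le_rfl h; omega
    · exact hzs n hn.le h
  have du : ∀ n, n ≤ M → u n ∉ [y L, zs] := by
    intro n hn h
    simp at h
    rcases h with h | h
    · have := hdis L n le_rfl hn h.symm; omega
    · exact hzs2 n hn h
  have pbase : ∀ v ∈ [y L, zs], v ∉ X ∧ (v = zs ∨ (∃ i, i ≤ L ∧ y i = v) ∨ ∃ j, j ≤ M ∧ u j = v) := by
    intro v hv
    simp at hv
    rcases hv with rfl | rfl
    · exact ⟨hLX, Or.inr (Or.inl ⟨L, le_rfl, rfl⟩)⟩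
    · exact ⟨hzsX, Or.inl rfl⟩
  have papp : ∀ l l' : List V,
      (∀ v ∈ l, v ∉ X ∧ (v = zs ∨ (∃ i, i ≤ L ∧ y i = v) ∨ ∃ j, j ≤ M ∧ u j = v)) →
      (∀ v ∈ l', v ∉ X ∧ (v = zs ∨ (∃ i, i ≤ L ∧ y i = v) ∨ ∃ j, j ≤ M ∧ u j = v)) →
      (∀ v ∈ l ++ l', v ∉ X ∧ (v = zs ∨ (∃ i, i ≤ L ∧ y i = v) ∨ ∃ j, j ≤ M ∧ u j = v)) := by
    intro l l' h h' v hv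
    rcases List.mem_append.1 hv with hv | hv
    · exact h v hv
    · exact h' v hv
  have pyB : ∀ i j, j ≤ L → (∀ n, i < n → n ≤ j → y n ∉ X) → ∀ v ∈ segB y i j,
      v ∉ X ∧ (v = zs ∨ (∃ i, i ≤ L ∧ y i = v) ∨ ∃ j, j ≤ M ∧ u j = v) := by
    intro i j hj h v hv
    obtain ⟨n, h1, h2, rfl⟩ := mem_segB.1 hv
    exact ⟨h n h1 h2, Or.inr (Or.inl ⟨n, by omega, rfl⟩)⟩
  have pyF : ∀ i j, j ≤ L → (∀ n, i ≤ n → n < j → y n ∉ X) → ∀ v ∈ segF y i j,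
      v ∉ X ∧ (v = zs ∨ (∃ i, i ≤ L ∧ y i = v) ∨ ∃ j, j ≤ M ∧ u j = v) := by
    intro i j hj h v hv
    obtain ⟨n, h1, h2, rfl⟩ := mem_segF.1 hv
    exact ⟨h n h1 h2, Or.inr (Or.inl ⟨n, by omega, rfl⟩)⟩
  have puB : ∀ i j, j ≤ M → (∀ n, i < n → n ≤ j → u n ∉ X) → ∀ v ∈ segB u i j,
      v ∉ X ∧ (v = zs ∨ (∃ i, i ≤ L ∧ y i = v) ∨ ∃ j, j ≤ M ∧ u j = v) := by
    intro i j hj h v hv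
    obtain ⟨n, h1, h2, rfl⟩ := mem_segB.1 hv
    exact ⟨h n h1 h2, Or.inr (Or.inr ⟨n, by omega, rfl⟩)⟩
  -- a good vertex
  by_cases hgood : ∃ i, i ≤ L ∧ y i ∈ X ∧ Ex D b X z₀ z₁ 2 1 1 (y i)
  · obtain ⟨i, hi, hiX, hex⟩ := hgood
    exact ⟨[y L, zs], y i, 1, 1, hiX, hbase i hi, nbase, pbase, exK hex⟩
  have hbad : ∀ i, i ≤ L → y i ∈ X → y i ∈ Bad ∧ Ex D b X z₀ z₁ 2 0 0 (y i) := by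
    intro i hi hiX
    rcases (hE _ hiX).2 with h | h
    · exact absurd ⟨i, hi, hiX, h⟩ hgood
    · exact h
  -- a gap
  by_cases hgap : ∃ i, i + b ≤ L ∧ y i ∈ X ∧ ∀ n, i < n → n < i + b → y n ∉ X
  · obtain ⟨i, hi, hiX, hno⟩ := hgap
    refine ⟨[y L, zs] ++ segB y i (i + b - 1), y i, 1, b, hiX, ?_, ?_, ?_, hE3 _ hiX⟩
    · have h1 := (hbase (i + b - 1) (by omega)).trans
        (hy.runB (i := i) (by omega) (by omega) rfl)
      exact h1.weak (by omega)
    · refine nodup_app nbase (hy.nodup_segB (by omega)) ?_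
      intro x hx
      obtain ⟨n, h1, h2, rfl⟩ := mem_segB.1 hx
      exact dy n (by omega)
    · exact papp _ _ pbase (pyB _ _ (by omega) fun n h1 h2 => hno n h1 (by omega))
  have hfirst : ∀ i, i < b → y i ∉ X := by
    refine counting hBad hb hy hlen (fun i hi h => (hbad i hi h).1) ?_
    intro i hi hiX
    by_contra hcon
    push Not at hcon
    exact hgap ⟨i, hi, hiX, hcon⟩
  have huM : u M ∉ X := by rw [hur]; exact hfirst 0 (by omega)
  by_cases hP2 : ∃ j, j ≤ M ∧ u j ∈ X
  · -- last vertex of P₂ in X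
    let j := Nat.findGreatest (fun j => u j ∈ X) M
    obtain ⟨j₀, hj₀, hj₀X⟩ := hP2
    have hjX : u j ∈ X := Nat.findGreatest_spec (P := fun j => u j ∈ X) hj₀ hj₀X
    have hjM : j ≤ M := Nat.findGreatest_le _
    have hjmax : ∀ n, j < n → n ≤ M → u n ∉ X := fun n h1 h2 =>
      Nat.findGreatest_is_greatest (P := fun j => u j ∈ X) h1 h2
    refine ⟨[y L, zs] ++ segB y 0 (b - 1) ++ segB u j M, u j, 1, b, hjX, ?_, ?_, ?_, hE3 _ hjX⟩
    · have h1 := (hbase (b - 1) (by omega)).trans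
        (hy.runB (i := 0) (by omega) (by omega) rfl)
      rw [← hur] at h1
      exact (h1.trans (hu.runB hjM le_rfl rfl)).weak (by omega)
    · refine nodup_app (nodup_app nbase (hy.nodup_segB (by omega)) ?_) (hu.nodup_segB le_rfl) ?_
      · intro x hx
        obtain ⟨n, h1, h2, rfl⟩ := mem_segB.1 hx
        exact dy n (by omega)
      · intro x hx hx'
        obtain ⟨n, h1, h2, rfl⟩ := mem_segB.1 hx
        rcases List.mem_append.1 hx' with hx' | hx'
        · exact du n h2 hx'
        · obtain ⟨n', h3, h4, h5⟩ := mem_segB.1 hx'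
          have := hdis n' n (by omega) h2 h5; omega
    · exact papp _ _ (papp _ _ pbase (pyB _ _ (by omega) fun n h1 h2 => hfirst n (by omega)))
        (puB _ _ le_rfl hjmax)
  have hP2' : ∀ n, n ≤ M → u n ∉ X := fun n hn h => hP2 ⟨n, hn, h⟩
  have hP1 : ∃ i, i ≤ L ∧ y i ∈ X := hmeet.resolve_right hP2
  let i₀ := Nat.find hP1
  obtain ⟨hi₀L, hi₀X⟩ : i₀ ≤ L ∧ y i₀ ∈ X := Nat.find_spec hP1
  have hmin : ∀ n, n < i₀ → y n ∉ X := by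
    intro n hn h
    exact Nat.find_min hP1 hn ⟨by omega, h⟩
  have hi₀b : b ≤ i₀ := by
    by_contra hcon
    exact hfirst i₀ (by omega) hi₀X
  have hi₀lt : i₀ < L := by
    rcases hi₀L.lt_or_eq with h | h
    · exact h
    · rw [h] at hi₀X; exact absurd hi₀X hLX
  have hE2 := (hbad i₀ hi₀L hi₀X).2
  -- the run  z_ℓ → z* ← r ⇜ f
  have hl₀ : Run D b 0 b (y L) ([y L, zs] ++ segB u 0 M) 1 (1 + (M - 0)) (u 0) := by
    have h1 := hbase 0 (by omega)
    rw [← hur] at h1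
    exact h1.trans (hu.runB (Nat.zero_le _) le_rfl rfl)
  have nl₀ : ([y L, zs] ++ (segB u 0 M ++ [u 0])).Nodup := by
    refine nodup_app nbase (nodup_app (hu.nodup_segB le_rfl) (by simp) ?_) ?_
    · intro x hx hx'
      simp at hx
      obtain ⟨n', h3, h4, h5⟩ := mem_segB.1 hx'
      have := hu.inj n' 0 h4 (by omega) (h5.trans hx); omega
    · intro x hx
      rcases List.mem_append.1 hx with hx | hx
      · obtain ⟨n', h3, h4, rfl⟩ := mem_segB.1 hx
        exact du n' h4
      · simp at hx; rw [hx]; exact du 0 (by omega)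
  have pl₀ := papp _ _ pbase (papp _ [u 0] (puB 0 M le_rfl fun n _ h => hP2' n h) (by
      intro v hv
      simp at hv
      subst hv
      exact ⟨hP2' 0 (by omega), Or.inr (Or.inr ⟨0, by omega, rfl⟩)⟩))
  have dl₀ : ∀ n, 1 ≤ n → n < L → y n ∉ [y L, zs] ++ (segB u 0 M ++ [u 0]) := by
    intro n hn hnL h
    rcases List.mem_append.1 h with h | h
    · exact dy n hnL h
    · rcases List.mem_append.1 h with h | h
      · obtain ⟨n', h3, h4, h5⟩ := mem_segB.1 h
        have := hdis n n' (by omega) h4 h5.symm; omega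
      · simp at h
        have := hdis n 0 (by omega) (by omega) h; omega
  have hE2' : ∀ r, Ex D b X z₀ z₁ 4 2 r (y i₀) := fun r => hE2.shift.mono (Nat.zero_le r)
  rcases hextra with hA | ⟨k, hk1, hkL, hB⟩
  · have h1 := (hl₀.sw (by omega)).fstep rfl hA
    refine ⟨_, y i₀, 2, _, hi₀X, h1.trans (hy.runF (i := 1) (j := i₀) (by omega) (by omega) rfl), ?_, ?_, hE2' _⟩
    · rw [List.append_assoc [y L, zs]]
      refine nodup_app nl₀ (hy.nodup_segF (by omega)) ?_
      intro x hx
      obtain ⟨n, h1, h2, rfl⟩ := mem_segF.1 hx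
      exact dl₀ n h1 (by omega)
    · rw [List.append_assoc [y L, zs]]
      exact papp _ _ pl₀ (pyF _ _ (by omega) fun n _ h => hmin n h)
  · by_cases hkL' : k = L
    · subst hkL'
      have h1 : Run D b 0 b (y k) [y k] 0 (b + 1) (u 0) := Run.nil.fstep rfl hB
      have h2 := h1.trans (hu.runF (Nat.zero_le M) le_rfl rfl)
      rw [hur] at h2
      have h3 := h2.trans (hy.runF (Nat.zero_le i₀) hi₀L rfl)
      refine ⟨_, y i₀, 0, _, hi₀X, h3, ?_, ?_, exK (hE2.mono (Nat.zero_le _))⟩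
      · refine nodup_app (nodup_app (by simp) (hu.nodup_segF (by omega)) ?_) (hy.nodup_segF (by omega)) ?_
        · intro x hx hx'
          obtain ⟨n, h1, h2, rfl⟩ := mem_segF.1 hx
          simp at hx'
          exact du n h2.le (by simp [hx'])
        · intro x hx hx'
          obtain ⟨n, h1, h2, rfl⟩ := mem_segF.1 hx
          rcases List.mem_append.1 hx' with hx' | hx'
          · simp at hx'
            exact dy n (by omega) (by simp [hx'])
          · obtain ⟨n', h3, h4, h5⟩ := mem_segF.1 hx'
            have := hdis n n' (by omega) (by omega) h5.symm; omega
      · refine papp _ _ (papp _ _ ?_ ?_) (pyF _ _ (by omega) fun n _ h => hmin n h)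
        · intro v hv
          exact pbase v (by simp at hv; simp [hv])
        · intro v hv
          obtain ⟨n, h1, h2, rfl⟩ := mem_segF.1 hv
          exact ⟨hP2' n (by omega), Or.inr (Or.inr ⟨n, by omega, rfl⟩)⟩
    · have h1 := hl₀.bstep rfl hB
      by_cases hki : k < i₀
      · have h2 := (h1.sw (by omega)).trans (hy.runF (i := k) (j := i₀) (by omega) (by omega) rfl)
        refine ⟨_, y i₀, 2, _, hi₀X, h2, ?_, ?_, hE2' _⟩
        · rw [List.append_assoc [y L, zs]]
          refine nodup_app nl₀ (hy.nodup_segF (by omega)) ?_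
          intro x hx
          obtain ⟨n, h1, h2, rfl⟩ := mem_segF.1 hx
          exact dl₀ n (by omega) (by omega)
        · rw [List.append_assoc [y L, zs]]
          exact papp _ _ pl₀ (pyF _ _ (by omega) fun n _ h => hmin n h)
      · let j := Nat.findGreatest (fun j => y j ∈ X) k
        have hjX : y j ∈ X := Nat.findGreatest_spec (P := fun j => y j ∈ X) (by omega : i₀ ≤ k) hi₀X
        have hjk : j ≤ k := Nat.findGreatest_le _
        have hji : i₀ ≤ j := Nat.le_findGreatest (by omega) hi₀X
        have hjmax : ∀ n, j < n → n ≤ k → y n ∉ X := fun n h1 h2 =>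
          Nat.findGreatest_is_greatest (P := fun j => y j ∈ X) h1 h2
        have h2 := h1.trans (hy.runB (i := j) (j := k) hjk (by omega) rfl)
        refine ⟨_, y j, 1, b, hjX, h2.weak (by omega), ?_, ?_, hE3 _ hjX⟩
        · rw [List.append_assoc [y L, zs]]
          refine nodup_app nl₀ (hy.nodup_segB (by omega)) ?_
          intro x hx
          obtain ⟨n, h1, h2, rfl⟩ := mem_segB.1 hx
          exact dl₀ n (by omega) (by omega)
        · rw [List.append_assoc [y L, zs]]
          exact papp _ _ pl₀ (pyB _ _ (by omega) hjmax)

end Paper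

namespace Paper

variable {V : Type*} {D : V → V → Prop} {b : ℕ}

/-- the spine of a chain as a function on `ℕ` -/
def GChain.y {m : ℕ} (C : GChain D b m) (n : ℕ) : V := C.v ⟨min n m, by omega⟩

theorem GChain.v_eq {m : ℕ} (C : GChain D b m) (j : Fin (m + 1)) : C.v j = C.y j.val := by
  unfold GChain.y
  congr 1
  ext
  have := j.isLt
  simp only
  omega

theorem GChain.pathFn {m : ℕ} (C : GChain D b m) : PathFn D m C.y := by
  constructor
  · intro i hi
    have := C.spine ⟨i, hi⟩
    rw [C.v_eq, C.v_eq] at this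
    exact this
  · intro i j hi hj h
    have := C.inj h
    simp only [Fin.mk.injEq] at this
    omega

/-- number of nontrivial gadgets from position `j` on -/
def GChain.cnt {m : ℕ} (C : GChain D b m) (j : ℕ) : ℕ := (C.A2.filter (fun i => j ≤ i.val)).card

theorem GChain.cnt_succ {m : ℕ} (C : GChain D b m) (j : ℕ) : C.cnt j ≤ C.cnt (j + 1) + 1 := by
  unfold GChain.cnt
  by_cases hj : j < m
  · have h : C.A2.filter (fun i => j ≤ i.val) ⊆
        insert ⟨j, hj⟩ (C.A2.filter (fun i => j + 1 ≤ i.val)) := by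
      intro i hi
      simp only [Finset.mem_filter, Finset.mem_insert, Fin.ext_iff] at hi ⊢
      have := hi.2
      by_cases h : i.val = j
      · exact Or.inl h
      · exact Or.inr ⟨hi.1, by omega⟩
    exact (Finset.card_le_card h).trans (Finset.card_insert_le _ _)
  · have h : C.A2.filter (fun i => j ≤ i.val) = ∅ := by
      ext i
      have := i.isLt
      simp only [Finset.mem_filter, Finset.notMem_empty, iff_false]
      omega
    rw [h]
    simp

theorem GChain.cnt_add {m : ℕ} (C : GChain D b m) (j d : ℕ) : C.cnt j ≤ C.cnt (j + d) + d := by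
  induction d with
  | zero => simp
  | succ d ih =>
    have := C.cnt_succ (j + d)
    rw [add_assoc] at this
    omega

theorem GChain.cnt_le {m : ℕ} (C : GChain D b m) (j : ℕ) : C.cnt j ≤ m - j := by
  have h0 : C.cnt (max j m) = 0 := by
    unfold GChain.cnt
    rw [Finset.card_eq_zero]
    ext i
    have := i.isLt
    simp only [Finset.mem_filter, Finset.notMem_empty, iff_false]
    omega
  have := C.cnt_add j (m - j)
  rw [show j + (m - j) = max j m by omega, h0] at this
  omega

theorem GChain.spine_run {m : ℕ} (C : GChain D b m) (hb : 1 ≤ b) (k : ℕ) :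
    ∀ j, j ≤ m → k * (b + 1) + b ≤ C.cnt j → ∃ l, Run D b 0 0 (C.y j) l (2 * k) b (C.y m) ∧
      l.Nodup ∧ ∀ x ∈ l, (∃ n, j ≤ n ∧ n < m ∧ C.y n = x) ∨
        ((∀ n, n ≤ m → C.y n ≠ x) ∧ ∃ i, ∃ hi : i ∈ C.A2, j < i.val ∧ x ∈ (C.gad i hi).verts) := by
  have hP := C.pathFn
  induction k with
  | zero =>
    intro j hj hc
    have := C.cnt_le j
    refine ⟨segF C.y j m, ((hP.runF (b := b) (r := 0) hj le_rfl rfl).weak (by omega)),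
      hP.nodup_segF (by omega), ?_⟩
    intro x hx
    exact Or.inl (mem_segF.1 hx)
  | succ k ih =>
    intro j hj hc
    have h1 := C.cnt_add j b
    have h2 : (k + 1) * (b + 1) = k * (b + 1) + (b + 1) := by ring
    have hne : (C.A2.filter (fun i => j + b ≤ i.val)).Nonempty := by
      rw [← Finset.card_pos]
      change 0 < C.cnt (j + b)
      omega
    obtain ⟨i, hi, hmin⟩ := Finset.exists_min_image _ (fun i : Fin m => i.val) hne
    rw [Finset.mem_filter] at hi
    obtain ⟨hiA, hji⟩ := hi
    have hcnt : C.cnt (j + b) = C.cnt i.val := by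
      unfold GChain.cnt
      congr 1
      ext i'
      simp only [Finset.mem_filter]
      constructor
      · rintro ⟨h, h'⟩
        exact ⟨h, hmin i' (Finset.mem_filter.2 ⟨h, h'⟩)⟩
      · rintro ⟨h, h'⟩
        exact ⟨h, by omega⟩
    have h3 := C.cnt_succ i.val
    have him := i.isLt
    obtain ⟨l, hl, hln, hlm⟩ := ih (i.val + 1) (by omega) (by omega)
    obtain ⟨lg, hg, hgn, hgX, hgq⟩ := (C.gad i hiA).toGD.detour hb
    rw [C.hp, C.hq, C.v_eq, C.v_eq] at hg
    rw [C.hq, C.v_eq] at hgq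
    simp only [Fin.val_castSucc, Fin.val_succ] at hg hgq
    have hgm : ∀ x ∈ lg, x = C.y i.val ∨ ((∀ n, n ≤ m → C.y n ≠ x) ∧ x ∈ (C.gad i hiA).verts) := by
      intro x hx
      by_cases h : ∃ n, n ≤ m ∧ C.y n = x
      · obtain ⟨n, hn, rfl⟩ := h
        have hv := C.v_eq ⟨n, by omega⟩
        have := C.hspine i hiA ⟨n, by omega⟩ (by rw [hv]; exact hgX _ hx)
        simp only [Fin.ext_iff, Fin.val_castSucc, Fin.val_succ] at this
        rcases this with h | h
        · left; rw [h]
        · rw [h] at hx; exact absurd hx hgq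
      · push Not at h
        exact Or.inr ⟨h, hgX _ hx⟩
    have hF := (hP.runF (b := b) (i := j) (j := i.val) (k := 0) (r := 0)
      (by omega) (by omega) rfl).weak (show b ≤ _ by omega)
    have hS := hl.shift
    rw [zero_add] at hS
    refine ⟨segF C.y j i.val ++ (lg ++ l), ?_, ?_, ?_⟩
    · rw [mul_add]
      exact hF.trans (hg.trans hS)
    · refine nodup_app (hP.nodup_segF (by omega)) (nodup_app hgn hln ?_) ?_
      · intro x hx hxg
        rcases hgm x hxg with rfl | ⟨h, hX⟩ <;> rcases hlm _ hx with ⟨n, h1, h2, h3⟩ | ⟨h', i', hi', h1, h2⟩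
        · have := hP.inj _ _ (by omega) (by omega) h3
          omega
        · exact h' i.val (by omega) rfl
        · exact h n (by omega) h3
        · obtain ⟨q, hq⟩ := C.hdisj i hiA i' hi' (by rintro rfl; omega) x hX h2
          rw [C.v_eq] at hq
          exact h q.val (by have := q.isLt; omega) hq.symm
      · intro x hx hxs
        obtain ⟨n, hn1, hn2, rfl⟩ := mem_segF.1 hxs
        rw [List.mem_append] at hx
        rcases hx with hx | hx
        · rcases hgm _ hx with h | ⟨h, hX⟩
          · have := hP.inj _ _ (by omega) (by omega) h
            omega
          · exact h n (by omega) rfl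
        · rcases hlm _ hx with ⟨n', h1, h2, h3⟩ | ⟨h', _⟩
          · have := hP.inj _ _ (by omega) (by omega) h3
            omega
          · exact h' n (by omega) rfl
    · intro x hx
      rw [List.mem_append, List.mem_append] at hx
      rcases hx with hx | hx | hx
      · obtain ⟨n, hn1, hn2, rfl⟩ := mem_segF.1 hx
        exact Or.inl ⟨n, hn1, by omega, rfl⟩
      · rcases hgm _ hx with h | ⟨h, hX⟩
        · exact Or.inl ⟨i.val, by omega, by omega, h.symm⟩
        · exact Or.inr ⟨h, i, hiA, by omega, hX⟩
      · rcases hlm _ hx with ⟨n', h1, h2, h3⟩ | ⟨h', i', hi', h1, h2⟩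
        · exact Or.inl ⟨n', by omega, h2, h3⟩
        · exact Or.inr ⟨h', i', hi', by omega, h2⟩

theorem GChain.firstOK {m : ℕ} (C : GChain D b m) (hb : 1 ≤ b) (hm : 0 < m) :
    FirstOK D b (C.gadVerts ⟨0, hm⟩) (C.y 0) (C.y 1) := by
  unfold GChain.gadVerts
  split_ifs with h
  · have := (C.gad _ h).toGD.firstOK hb
    rw [C.hp, C.hq, C.v_eq, C.v_eq] at this
    exact this
  · rw [C.v_eq, C.v_eq]
    exact firstOK_triv hb

theorem GChain.spine_X {m : ℕ} (C : GChain D b m) (hm : 0 < m) {n : ℕ} (hn : n ≤ m)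
    (h : C.y n ∈ C.gadVerts ⟨0, hm⟩) : n = 0 ∨ n = 1 := by
  unfold GChain.gadVerts at h
  split_ifs at h with h0
  · have hv := C.v_eq ⟨n, by omega⟩
    simp only at hv
    rw [← hv] at h
    have := C.hspine _ h0 _ h
    simpa [Fin.ext_iff] using this
  · rw [C.v_eq, C.v_eq] at h
    simp only [Set.mem_insert_iff, Set.mem_singleton_iff] at h
    rcases h with h | h
    · exact Or.inl (C.pathFn.inj _ 0 hn (Nat.zero_le _) h)
    · exact Or.inr (C.pathFn.inj _ 1 hn hm h)

theorem GChain.X_sub {m : ℕ} (C : GChain D b m) (hm : 0 < m) {x : V}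
    (h : x ∈ C.gadVerts ⟨0, hm⟩) : x ∈ C.verts := by
  unfold GChain.gadVerts at h
  split_ifs at h with h0
  · exact Or.inr ⟨_, h0, h⟩
  · rcases h with rfl | rfl <;> exact Or.inl ⟨_, rfl⟩

theorem GChain.combine {m : ℕ} (C : GChain D b m) (hb : 1 ≤ b) (hm : 0 < m) {a : ℕ} (ha : 2 ≤ a)
    (hA2 : (a + 3) * (b + 1) - 2 ≤ C.A2.card) {l : List V} {x : V} {k r : ℕ}
    (hrun : Run D b 0 b (C.y m) l k r x) (hl : l.Nodup)
    (hlX : ∀ v ∈ l, v ∉ C.gadVerts ⟨0, hm⟩ ∧ (v = C.y m ∨ v ∉ C.verts))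
    (hex : Ex D b (C.gadVerts ⟨0, hm⟩) (C.y 0) (C.y 1) 4 k r x) :
    ContainsSubdivisionOf D (Cab a b) := by
  obtain ⟨le, k', t, hk', hk4, hre, hen, heX, hz1, hte, ht⟩ := hex
  have hP := C.pathFn
  have hc0 : C.cnt 0 = C.A2.card := by simp [GChain.cnt]
  have hcm := C.cnt_le 0
  have hexp : (a + 3) * (b + 1) = a * (b + 1) + 3 * b + 3 := by ring
  obtain ⟨s, hs, hts⟩ : ∃ s, s ≤ 1 ∧ C.y s = t := by
    rcases ht with h | h
    · exact ⟨0, by omega, h.symm⟩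
    · exact ⟨1, by omega, h.symm⟩
  have hcs : C.cnt 0 ≤ C.cnt s + 1 := by
    have := C.cnt_add 0 s
    rw [zero_add] at this
    omega
  have hle : (a - k' / 2) * (b + 1) ≤ a * (b + 1) := Nat.mul_le_mul_right _ (by omega)
  obtain ⟨ls, hrs, hsn, hsm⟩ := C.spine_run hb (a - k' / 2) s (by omega) (by omega)
  have htot := hrun.trans hre
  have h2 := htot.shifts (a - k' / 2)
  rw [zero_add, show k' + 2 * (a - k' / 2) = 2 * a by omega] at h2
  have h3 := hrs.trans h2
  rw [← hts] at h3
  refine h3.closed ha hb (nodup_app hsn (nodup_app hl hen ?_) ?_)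
  · intro v hv hv'
    exact (hlX v hv').1 (heX v hv)
  · intro v hv hvs
    rw [List.mem_append] at hv
    have hvC : v ∈ C.verts := by
      rcases hsm v hvs with ⟨n, _, hn, rfl⟩ | ⟨_, i, hi, _, h⟩
      · exact Or.inl ⟨_, rfl⟩
      · exact Or.inr ⟨i, hi, h⟩
    rcases hv with hv | hv
    · rcases (hlX v hv).2 with rfl | h
      · rcases hsm _ hvs with ⟨n, _, hn, h⟩ | ⟨h, _⟩
        · have := hP.inj _ _ (by omega) (by omega) h
          omega
        · exact h m le_rfl rfl
      · exact h hvC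
    · have hvX := heX v hv
      rcases hsm v hvs with ⟨n, hsn, hn, rfl⟩ | ⟨hns, i, hi, hsi, h⟩
      · rcases C.spine_X hm (by omega) hvX with h | h
        · subst h
          have : s = 0 := by omega
          subst this
          rw [hts] at hv
          exact hte hv
        · subst h
          exact hz1 hv
      · unfold GChain.gadVerts at hvX
        split_ifs at hvX with h0
        · obtain ⟨q, hq⟩ := C.hdisj _ h0 i hi
            (by rintro rfl; simp at hsi) v hvX h
          rw [C.v_eq] at hq
          exact hns q.val (by have := q.isLt; omega) hq.symm
        · rw [C.v_eq, C.v_eq] at hvX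
          rcases hvX with h | h
          · exact hns _ (by simp) h.symm
          · exact hns _ (by simp; omega) h.symm

end Paper
namespace Paper

/-- Let `a ≥ 2`, `b ≥ 1` and let `𝒞` be a chain in `D` with spine
`z_0, …, z_ℓ` and `|A₂| ≥ (a+3)(b+1) − 2`. If either (1) some vertex of the first
gadget `G_{(z_0,z_1)}` receives an arc from `z_ℓ`, or (2) there is `z* ∉ V(𝒞)` with
`(z_ℓ, z*) ∈ A(D)` and an extended type-II gadget `G*` with `p(G*) = z_ℓ`,
`q(G*) = z*`, `V(G_{(z_0,z_1)}) ∩ V(G*) ≠ ∅` and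
`V(𝒞) ∩ V(G*) ⊆ V(G_{(z_0,z_1)}) ∪ {z_ℓ}`, then `D` contains a subdivision of
`C_{a,b}`. -/
theorem stmt_12 {V : Type*} [Fintype V] (D : V → V → Prop) (hloop : ∀ v, ¬ D v v)
    (a b m : ℕ) (ha : 2 ≤ a) (hb : 1 ≤ b) (hm : 0 < m)
    (C : GChain D b m) (hA2 : (a + 3) * (b + 1) - 2 ≤ C.A2.card)
    (hcond :
      (∃ x ∈ C.gadVerts ⟨0, hm⟩, D (C.v (Fin.last m)) x) ∨
      (∃ z : V, z ∉ C.verts ∧ D (C.v (Fin.last m)) z ∧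
        ∃ Gs : ExtIIGadget D b, Gs.p = C.v (Fin.last m) ∧ Gs.q = z ∧
          (∃ x, x ∈ C.gadVerts ⟨0, hm⟩ ∧ x ∈ Gs.verts) ∧
          (∀ x, x ∈ C.verts → x ∈ Gs.verts →
            x ∈ C.gadVerts ⟨0, hm⟩ ∨ x = C.v (Fin.last m)))) :
    ContainsSubdivisionOf D (Cab a b) := by
  have hP := C.pathFn
  have hF := C.firstOK hb hm
  have hlast : C.v (Fin.last m) = C.y m := C.v_eq _
  have hm2 : 2 ≤ m := by
    have h1 := C.cnt_le 0
    have hc0 : C.cnt 0 = C.A2.card := by simp [GChain.cnt]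
    have hexp : (a + 3) * (b + 1) = a * (b + 1) + 3 * b + 3 := by ring
    omega
  have hmX : C.y m ∉ C.gadVerts ⟨0, hm⟩ := by
    intro h
    have := C.spine_X hm le_rfl h
    omega
  rcases hcond with ⟨x, hx, hxa⟩ | ⟨z, hz, hza, Gs, hp, hq, ⟨x, hxX, hxG⟩, hsub⟩
  · rw [hlast] at hxa
    obtain ⟨Bad, _, hB⟩ := hF
    have hrun : Run D b 0 b (C.y m) ([] ++ [C.y m]) 0 (b + 1) x := Run.nil.fstep rfl hxa
    refine C.combine hb hm ha hA2 (hrun.weak (Nat.le_succ b)) (by simp) ?_ ?_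
    · intro v hv
      simp only [List.nil_append, List.mem_singleton] at hv
      subst hv
      exact ⟨hmX, Or.inl rfl⟩
    · obtain ⟨l, k', t, h1, h2, h3⟩ := (hB x hx).1
      exact ⟨l, k', t, h1, by omega, h3⟩
  · subst hq
    rw [hlast] at hp hsub
    obtain ⟨L, y, hLl, hy, hy0, hyL, hym, hyi⟩ := exists_pathFn Gs.path₁ Gs.first₁ Gs.last₁
    obtain ⟨u₀, hu₀⟩ : ∃ u₀, Gs.P₂.head? = some u₀ := by
      cases h : Gs.P₂ with
      | nil => exact absurd h Gs.path₂.1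
      | cons a l => exact ⟨a, rfl⟩
    obtain ⟨M, u, hMl, hu, hu0, huM, hum, hui⟩ := exists_pathFn Gs.path₂ hu₀ Gs.last₂
    have hlen := Gs.len₁
    have hlen2 := Gs.len₂
    have hb2 : 1 ≤ b ^ 2 := Nat.one_le_pow _ _ hb
    have hzX : Gs.q ∉ C.gadVerts ⟨0, hm⟩ := fun h => hz (C.X_sub hm h)
    have hyP : ∀ i, i ≤ L → y i ∈ Gs.P₁ := fun i hi => (hym _).2 ⟨i, hi, rfl⟩
    have huP : ∀ i, i ≤ M → u i ∈ Gs.P₂ := fun i hi => (hum _).2 ⟨i, hi, rfl⟩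
    obtain ⟨l, x', k, r, hx', hrun, hln, hlm, hex⟩ := star (zs := Gs.q) hF hb hy (by omega)
      (fun i hi => Gs.toq _ (hyP i hi))
      (fun i hi h => Gs.hq (h ▸ hyP i hi)) hu (by omega) (huM.trans hy0.symm)
      (by
        intro i j hi hj h
        have hr := Gs.inter _ (hyP i hi) (h ▸ huP j hj)
        exact ⟨hy.inj _ _ hi (by omega) (hr.trans hy0.symm),
          hu.inj _ _ hj le_rfl (h.symm.trans (hr.trans huM.symm))⟩)
      (fun j hj h => Gs.hq₂ (h ▸ huP j hj))
      (by
        rcases Gs.extra with ⟨z', y', h1, h2, h3⟩ | ⟨w, z', h1, h2, h3, h4⟩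
        · left
          rw [hu₀] at h1
          have hL1 : 1 ≤ L := by
            have := List.getElem?_eq_some_iff.1 h2
            obtain ⟨h, _⟩ := this
            omega
          rw [hyi 1 hL1] at h2
          rw [hu0, Option.some.inj h1, Option.some.inj h2]
          exact h3
        · right
          obtain ⟨k, hk, rfl⟩ := (hym w).1 h1
          refine ⟨k, ?_, hk, ?_⟩
          · rcases Nat.eq_zero_or_pos k with rfl | h
            · exact absurd hy0 h2
            · exact h
          · rw [hu₀] at h3
            rw [hu0, Option.some.inj h3]
            exact h4)
      hzX (by rw [hyL, hp]; exact hmX)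
      (by
        rcases hxG with h | h | h
        · rw [h] at hxX
          exact absurd hxX hzX
        · obtain ⟨i, hi, rfl⟩ := (hym x).1 h
          exact Or.inl ⟨i, hi, hxX⟩
        · obtain ⟨i, hi, rfl⟩ := (hum x).1 h
          exact Or.inr ⟨i, hi, hxX⟩)
    rw [hyL, hp] at hrun
    refine C.combine hb hm ha hA2 hrun hln ?_ hex
    intro v hv
    obtain ⟨h1, h2⟩ := hlm v hv
    refine ⟨h1, ?_⟩
    by_cases hvC : v ∈ C.verts
    · have hvG : v ∈ Gs.verts := by
        rcases h2 with h | ⟨i, hi, rfl⟩ | ⟨j, hj, rfl⟩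
        · exact Or.inl h
        · exact Or.inr (Or.inl (hyP i hi))
        · exact Or.inr (Or.inr (huP j hj))
      exact Or.inl ((hsub v hvC hvG).resolve_left h1)
    · exact Or.inr hvC

end Paper
end
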